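/- arXiv:1007.0279 — 10 statements merged into one kernel-verified Lean document; each statement's English description precedes it below -/
import Mathlib

section
/- Let M be a matroid on a finite ground set E, with rank function rk and rank r = rk(E). For any minor N of M on ground set S with rank function rk_N, define the characteristic polynomial χ(N; λ) = Σ_{B ⊆ S} (−1)^{|B|} λ^{rk_N(S) − rk_N(B)}. Then for all complex numbers λ and x, Σ_{B ⊆ E} λ^{r − rk(B)} (x − 1)^{|B|} = Σ_{U} χ(M/U; λ) x^{|U|}, where the right-hand sum ranges over all flats U of M, and M/U denotes the contraction of M by U. (This is the identity (x−1)^r R(M; λ/(x−1), x−1) = Σ_{U ∈ L(M)} χ(M/U; λ) x^{|U|} with denominators cleared, where R(M; λ, x) = Σ_{B ⊆ E} λ^{r − rk(B)} x^{|B| − rk(B)} is the rank generating polynomial.) -/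
open Finset

/-- If `e` is spanned by `U`, then it is spanned by every superset of `U`. -/
theorem rk_insert_eq_of_subset {ι : Type*} [DecidableEq ι] {rk : Finset ι → ℕ}
    (hmono : ∀ A B : Finset ι, A ⊆ B → rk A ≤ rk B)
    (hsubmod : ∀ A B : Finset ι, rk (A ∪ B) + rk (A ∩ B) ≤ rk A + rk B)
    {U A : Finset ι} {e : ι} (hUA : U ⊆ A) (he : rk (insert e U) ≤ rk U) :
    rk (insert e A) = rk A := by
  refine le_antisymm ?_ (hmono _ _ (subset_insert e A))
  have h := hsubmod A (insert e U)
  have hunion : A ∪ insert e U = insert e A := by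
    rw [union_insert, union_eq_left.2 hUA]
  have hinter := hmono U (A ∩ insert e U) (subset_inter hUA (subset_insert e U))
  rw [hunion] at h
  omega

/-- An alternating sum over subsets of `S` vanishes when toggling some `e ∈ S` does not change
the summand. -/
theorem sum_powerset_neg_one_pow_mul_eq_zero {ι R : Type*} [DecidableEq ι] [CommRing R]
    {S : Finset ι} {e : ι} (he : e ∈ S) (f : Finset ι → R)
    (hf : ∀ B, f (insert e B) = f B) :
    ∑ B ∈ S.powerset, (-1 : R) ^ B.card * f B = 0 := by
  rw [← insert_erase he, sum_powerset_insert (notMem_erase e S), ← sum_add_distrib]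
  refine sum_eq_zero fun B hB => ?_
  have heB : e ∉ B := fun h => notMem_erase e S (mem_powerset.1 hB h)
  rw [hf, card_insert_of_notMem heB]
  ring

/-- Expanding `(x - 1) ^ |A|` over the subsets `U` of `A` and summing over `U` first. -/
theorem sum_mul_sub_one_pow_card {ι R : Type*} [Fintype ι] [DecidableEq ι] [CommRing R]
    (f : Finset ι → R) (x : R) :
    ∑ A : Finset ι, f A * (x - 1) ^ A.card
      = ∑ U : Finset ι,
          (∑ B ∈ (univ \ U).powerset, (-1 : R) ^ B.card * f (B ∪ U)) * x ^ U.card := by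
  have hexpand : ∀ A : Finset ι, f A * (x - 1) ^ A.card
      = ∑ U ∈ A.powerset, f A * (x ^ U.card * (-1) ^ (A.card - U.card)) := fun A => by
    rw [← mul_sum, sum_pow_mul_eq_add_pow, sub_eq_add_neg]
  simp_rw [hexpand, sum_mul]
  rw [sum_comm' (t' := univ) (s' := fun U => univ.filter (U ⊆ ·)) (by simp)]
  refine sum_congr rfl fun U _ => ?_
  refine sum_nbij' (· \ U) (· ∪ U) ?_ ?_ ?_ ?_ ?_
  · intro A _
    exact mem_powerset.2 (sdiff_subset_sdiff (subset_univ A) le_rfl)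
  · intro B _
    simp
  · intro A hA
    exact sdiff_union_of_subset (mem_filter.1 hA).2
  · intro B hB
    exact union_sdiff_cancel_right (disjoint_of_subset_left (mem_powerset.1 hB) sdiff_disjoint)
  · intro A hA
    have hUA := (mem_filter.1 hA).2
    rw [sdiff_union_of_subset hUA, card_sdiff_of_subset hUA]
    ring

/-- **Lemma 2.1 (Crapo–Tutte identity, denominators cleared).**
For a matroid on a finite ground set given by its rank function `rk`,
`Σ_{B ⊆ E} λ^{r−rk(B)} (x−1)^{|B|} = Σ_{U flat} χ(M/U; λ) x^{|U|}`. -/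
theorem stmt_0
    {ι : Type*} [Fintype ι] [DecidableEq ι]
    (rk : Finset ι → ℕ)
    (hrk_empty : rk ∅ = 0)
    (hrk_mono : ∀ A B : Finset ι, A ⊆ B → rk A ≤ rk B)
    (hrk_step : ∀ (A : Finset ι) (e : ι), rk (insert e A) ≤ rk A + 1)
    (hrk_submod : ∀ A B : Finset ι, rk (A ∪ B) + rk (A ∩ B) ≤ rk A + rk B)
    (r : ℕ) (hr : r = rk Finset.univ)
    (lam x : ℂ) :
    ∑ B : Finset ι, lam ^ (r - rk B) * (x - 1) ^ B.card
      = ∑ U ∈ Finset.univ.filter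
            (fun U : Finset ι => ∀ e ∉ U, rk U < rk (insert e U)),
          (∑ B ∈ (Finset.univ \ U).powerset,
              (-1 : ℂ) ^ B.card * lam ^ ((r - rk U) - (rk (B ∪ U) - rk U)))
            * x ^ U.card := by
  have hexp : ∀ B U : Finset ι, (r - rk U) - (rk (B ∪ U) - rk U) = r - rk (B ∪ U) := by
    intro B U
    have := hrk_mono U (B ∪ U) subset_union_right
    omega
  simp_rw [hexp]
  rw [sum_mul_sub_one_pow_card (fun A => lam ^ (r - rk A)) x]
  refine (sum_subset (filter_subset _ _) fun U _ hU => ?_).symm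
  simp only [mem_filter, mem_univ, true_and, not_forall, not_lt] at hU
  obtain ⟨e, heU, he⟩ := hU
  rw [sum_powerset_neg_one_pow_mul_eq_zero (e := e) (by simpa using heU)
    (fun B => lam ^ (r - rk (B ∪ U))), zero_mul]
  intro B
  rw [insert_union, rk_insert_eq_of_subset hrk_mono hrk_submod subset_union_right he]
end

section
/- Let F be a finite field with q = |F| elements, let E be a finite set, and let G be a matrix with entries in F whose columns are indexed by E, of rank r. Then for every complex number x, Σ_{h : h is a flow of G} x^{|h^{-1}(0)|} = Σ_{U : U is a flat of M(G)} χ(M(G)/U; q) x^{|U|} = Σ_{B ⊆ E} q^{r − rk(B)} (x − 1)^{|B|}, where h^{-1}(0) = {e ∈ E : h(e) = 0}, the middle sum ranges over all flats U of M(G), and χ(M(G)/U; λ) = Σ_{B ⊆ E\U} (−1)^{|B|} λ^{(r − rk(U)) − (rk(B ∪ U) − rk(U))}. (The right-hand side equals (x−1)^r R(M(G); q/(x−1), x−1).) -/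
open Finset

/-- The column rank of `G` restricted to `B` is its row rank. -/
theorem finrank_span_columns_eq_finrank_span_restrict {F ι : Type*} [Field F] {n : ℕ}
    (G : Fin n → ι → F) (B : Finset ι) :
    Module.finrank F (Submodule.span F ((fun e => fun i => G i e) '' (B : Set ι))) =
      Module.finrank F ((Submodule.span F (Set.range G)).map
        (LinearMap.funLeft F F (Subtype.val : B → ι))) := by
  let A : Matrix (Fin n) B F := Matrix.of fun i e => G i e
  have hcol : (fun e => fun i => G i e) '' (B : Set ι) = Set.range A.col := by
    apply Set.Subset.antisymm
    · rintro _ ⟨e, he, rfl⟩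
      exact ⟨⟨e, he⟩, rfl⟩
    · rintro _ ⟨e, rfl⟩
      exact ⟨e, e.2, rfl⟩
  have hrow : (LinearMap.funLeft F F (Subtype.val : B → ι)) '' Set.range G = Set.range A.row := by
    rw [← Set.range_comp]
    rfl
  rw [Submodule.map_span, hcol, hrow, ← Matrix.rank_eq_finrank_span_cols,
    ← Matrix.rank_eq_finrank_span_row]

/-- There are `q ^ (r - rk B)` vectors of the row space of `G` which vanish on `B`. -/
theorem card_flows_vanishing_on {F : Type*} [Field F] [Fintype F] [DecidableEq F]
    {ι : Type*} [Fintype ι] [DecidableEq ι] {n : ℕ} (G : Fin n → ι → F)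
    (Flow : (ι → F) → Prop) [DecidablePred Flow]
    (hFlow : ∀ h : ι → F, Flow h ↔ h ∈ Submodule.span F (Set.range G)) (B : Finset ι) :
    #{h ∈ univ.filter Flow | ∀ e ∈ B, h e = 0} = Fintype.card F ^
      (Module.finrank F (Submodule.span F
          ((fun e => fun i => G i e) '' ((univ : Finset ι) : Set ι))) -
        Module.finrank F (Submodule.span F ((fun e => fun i => G i e) '' (B : Set ι)))) := by
  classical
  set V := Submodule.span F (Set.range G)
  let ρ : V →ₗ[F] (B → F) := (LinearMap.funLeft F F (Subtype.val : B → ι)).comp V.subtype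
  have hrange : Module.finrank F (LinearMap.range ρ) =
      Module.finrank F (Submodule.span F ((fun e => fun i => G i e) '' (B : Set ι))) := by
    rw [finrank_span_columns_eq_finrank_span_restrict, LinearMap.range_comp,
      Submodule.range_subtype]
  have huniv : Module.finrank F (Submodule.span F
      ((fun e => fun i => G i e) '' ((univ : Finset ι) : Set ι))) = Module.finrank F V := by
    rw [finrank_span_columns_eq_finrank_span_restrict]
    refine (LinearEquiv.finrank_eq (Submodule.equivMapOfInjective _ ?_ V)).symm
    exact LinearMap.funLeft_injective_of_surjective F F _ fun e => ⟨⟨e, mem_univ e⟩, rfl⟩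
  have hker : Module.finrank F V - Module.finrank F (LinearMap.range ρ) =
      Module.finrank F (LinearMap.ker ρ) := by
    have := ρ.finrank_range_add_finrank_ker
    omega
  rw [huniv, ← hrange, hker, ← Nat.card_eq_fintype_card,
    ← Module.natCard_eq_pow_finrank (K := F) (V := LinearMap.ker ρ), ← Fintype.card_coe,
    ← Nat.card_eq_fintype_card]
  refine Nat.card_congr
    { toFun := fun h => ⟨⟨h.1, (hFlow _).1 (by have := h.2; simp_all)⟩, ?_⟩
      invFun := fun h => ⟨h.1.1, ?_⟩
      left_inv := fun h => rfl
      right_inv := fun h => rfl }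
  · rw [LinearMap.mem_ker]
    funext e
    exact (mem_filter.1 h.2).2 e e.2
  · refine mem_filter.2 ⟨mem_filter.2 ⟨mem_univ _, (hFlow _).2 h.1.2⟩, fun e he => ?_⟩
    exact congrFun (LinearMap.mem_ker.1 h.2) ⟨e, he⟩

/-- A vector of the row space vanishing on `U` vanishes on every column index
whose column lies in the span of the columns in `U`. -/
theorem flow_eq_zero_of_mem_span {F ι : Type*} [Field F] {n : ℕ} (G : Fin n → ι → F)
    {h : ι → F} (hh : h ∈ Submodule.span F (Set.range G)) {U : Set ι} (hU : ∀ e ∈ U, h e = 0)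
    {e : ι} (he : (fun i => G i e) ∈ Submodule.span F ((fun e => fun i => G i e) '' U)) :
    h e = 0 := by
  obtain ⟨c, rfl⟩ := (Submodule.mem_span_range_iff_exists_fun F).1 hh
  have key : Submodule.span F ((fun e => fun i => G i e) '' U) ≤
      LinearMap.ker (Fintype.linearCombination F c) := by
    rw [Submodule.span_le]
    rintro _ ⟨e, he, rfl⟩
    simpa [Fintype.linearCombination_apply, mul_comm] using hU e he
  simpa [Fintype.linearCombination_apply, mul_comm] using key he

/-- Möbius inversion on the Boolean lattice, for a single set `Z`. -/
theorem sum_powerset_compl_neg_one_pow_ite {ι : Type*} [Fintype ι] [DecidableEq ι]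
    (U Z : Finset ι) :
    ∑ B ∈ (univ \ U).powerset, (-1 : ℂ) ^ #B * (if B ∪ U ⊆ Z then 1 else 0) =
      if Z = U then 1 else 0 := by
  by_cases hUZ : U ⊆ Z
  · have hfilter : (univ \ U).powerset.filter (fun B => B ∪ U ⊆ Z) = (Z \ U).powerset := by
      ext B
      simp only [mem_filter, mem_powerset, union_subset_iff, subset_sdiff, hUZ, and_true,
        subset_univ, true_and]
      tauto
    have hsum : ∑ B ∈ (Z \ U).powerset, (-1 : ℂ) ^ #B = if Z \ U = ∅ then 1 else 0 := by
      exact_mod_cast congrArg (Int.cast : ℤ → ℂ) (sum_powerset_neg_one_pow_card (x := Z \ U))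
    simp only [mul_ite, mul_one, mul_zero]
    rw [← sum_filter, hfilter, hsum]
    refine if_congr ?_ rfl rfl
    rw [sdiff_eq_empty_iff_subset]
    exact ⟨fun hZU => hZU.antisymm hUZ, fun hZU => hZU.subset⟩
  · rw [if_neg (fun hZU => hUZ hZU.ge)]
    refine sum_eq_zero fun B _ => ?_
    rw [if_neg fun hB => hUZ (subset_union_right.trans hB), mul_zero]

/-- **Lemma 2.2.** For a matrix `G` over a finite field `F` with `q` elements,
`Σ_{h flow} x^{|h⁻¹(0)|} = Σ_{U flat of M(G)} χ(M(G)/U; q) x^{|U|}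
  = Σ_{B ⊆ E} q^{r−rk(B)} (x−1)^{|B|}`. -/
theorem stmt_1
    {F : Type*} [Field F] [Fintype F] [DecidableEq F]
    {ι : Type*} [Fintype ι] [DecidableEq ι]
    {n : ℕ} (G : Fin n → ι → F)
    (q : ℕ) (hq : q = Fintype.card F)
    (rk : Finset ι → ℕ)
    (hrk : ∀ B : Finset ι,
      rk B = Module.finrank F (Submodule.span F ((fun e => fun i => G i e) '' (B : Set ι))))
    (r : ℕ) (hr : r = rk Finset.univ)
    (Flow : (ι → F) → Prop) [DecidablePred Flow]
    (hFlow : ∀ h : ι → F, Flow h ↔ h ∈ Submodule.span F (Set.range G))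
    (x : ℂ) :
    (∑ h ∈ Finset.univ.filter Flow,
        x ^ (Finset.univ.filter (fun e => h e = 0)).card
      = ∑ U ∈ Finset.univ.filter
            (fun U : Finset ι => ∀ e ∉ U, rk U < rk (insert e U)),
          (∑ B ∈ (Finset.univ \ U).powerset,
              (-1 : ℂ) ^ B.card * (q : ℂ) ^ ((r - rk U) - (rk (B ∪ U) - rk U)))
            * x ^ U.card) ∧
    (∑ h ∈ Finset.univ.filter Flow,
        x ^ (Finset.univ.filter (fun e => h e = 0)).card
      = ∑ B : Finset ι, (q : ℂ) ^ (r - rk B) * (x - 1) ^ B.card) := by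
  have hcount : ∀ B : Finset ι, (q : ℂ) ^ (r - rk B) =
      ∑ h ∈ univ.filter Flow, if B ⊆ univ.filter (fun e => h e = 0) then (1 : ℂ) else 0 := by
    intro B
    rw [hr, hrk, hrk, hq, ← Nat.cast_pow, ← card_flows_vanishing_on G Flow hFlow B, sum_boole]
    simp only [subset_iff, mem_filter, mem_univ, true_and]
  have hmono : ∀ {A B : Finset ι}, A ⊆ B → rk A ≤ rk B := by
    intro A B hAB
    rw [hrk, hrk]
    exact Submodule.finrank_mono (Submodule.span_mono (Set.image_mono (coe_subset.2 hAB)))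
  refine ⟨?_, ?_⟩
  · have hchar : ∀ U : Finset ι, (∑ B ∈ (univ \ U).powerset,
        (-1 : ℂ) ^ #B * (q : ℂ) ^ ((r - rk U) - (rk (B ∪ U) - rk U))) =
        ∑ h ∈ univ.filter Flow, if univ.filter (fun e => h e = 0) = U then (1 : ℂ) else 0 := by
      intro U
      simp_rw [← sum_powerset_compl_neg_one_pow_ite U]
      rw [sum_comm]
      refine sum_congr rfl fun B _ => ?_
      have hexp : (r - rk U) - (rk (B ∪ U) - rk U) = r - rk (B ∪ U) := by
        have := hmono (subset_union_right : U ⊆ B ∪ U)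
        omega
      rw [hexp, hcount, mul_sum]
    have hflat : ∀ h ∈ univ.filter Flow, univ.filter (fun e => h e = 0) ∈
        univ.filter (fun U : Finset ι => ∀ e ∉ U, rk U < rk (insert e U)) := by
      intro h hh
      simp only [mem_filter, mem_univ, true_and] at hh ⊢
      intro e he
      by_contra hlt
      refine he (flow_eq_zero_of_mem_span G ((hFlow h).1 hh)
        (U := (univ.filter (fun e => h e = 0) : Finset ι)) (by simp) ?_)
      rw [hrk, hrk, not_lt] at hlt
      rw [Submodule.eq_of_le_of_finrank_le (Submodule.span_mono
        (Set.image_mono (coe_subset.2 (subset_insert e _)))) hlt]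
      exact Submodule.subset_span ⟨e, by simp, rfl⟩
    simp_rw [hchar, sum_mul]
    rw [sum_comm]
    refine sum_congr rfl fun h hh => ?_
    simp_rw [ite_mul, one_mul, zero_mul]
    rw [sum_ite_eq, if_pos (hflat h hh)]
  · simp_rw [hcount, sum_mul]
    rw [sum_comm]
    refine sum_congr rfl fun h _ => ?_
    simp_rw [ite_mul, one_mul, zero_mul]
    rw [← sum_filter, filter_subset_univ]
    simpa using (sum_pow_mul_eq_add_pow (x - 1) 1 (univ.filter (fun e => h e = 0))).symm
end

section
/- (Cheshire-cat identity.) Let E be a finite set, A an additive abelian group, 𝔅 ⊆ A a subset, ℋ a set of functions E → A (called flows), S a commutative ring, m ≥ 1 an integer, and γ : 𝔅^{m+1} → S any function. Then Σ_{(f_1,…,f_{m+1})} Π_{e ∈ E} γ(f_1(e), f_2(e), …, f_{m+1}(e)) = Σ_{(h_1,…,h_m) ∈ ℋ^m} Π_{e ∈ E} ( Σ_{(b_1,…,b_{m+1})} γ(b_1, b_2, …, b_{m+1}) ), where the sum on the left ranges over all (m+1)-tuples (f_1,…,f_{m+1}) of functions f_j : E → 𝔅 such that f_j − f_{j+1}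 ∈ ℋ for all 1 ≤ j ≤ m, and the inner sum on the right ranges over all (m+1)-tuples (b_1,…,b_{m+1}) with b_j ∈ 𝔅 for all j and b_j − b_{j+1} = h_j(e) for all 1 ≤ j ≤ m. -/
open Finset

/-- **Lemma 2.3 (Cheshire-cat identity).** -/
theorem stmt_2
    {ι : Type*} [Fintype ι] [DecidableEq ι]
    {A : Type*} [AddCommGroup A] [Fintype A] [DecidableEq A]
    (𝔅 : Finset A)
    (ℋ : Finset (ι → A))
    {S : Type*} [CommRing S]
    (m : ℕ) (hm : 1 ≤ m)
    (γ : (Fin (m + 1) → A) → S) :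
    ∑ f ∈ Finset.univ.filter (fun f : Fin (m + 1) → ι → A =>
        (∀ (j : Fin (m + 1)) (e : ι), f j e ∈ 𝔅) ∧
        (∀ j : Fin m, f j.castSucc - f j.succ ∈ ℋ)),
      ∏ e : ι, γ (fun j => f j e)
    = ∑ h ∈ Finset.univ.filter (fun h : Fin m → ι → A => ∀ j : Fin m, h j ∈ ℋ),
        ∏ e : ι,
          ∑ b ∈ Finset.univ.filter (fun b : Fin (m + 1) → A =>
              (∀ j : Fin (m + 1), b j ∈ 𝔅) ∧
              (∀ j : Fin m, b j.castSucc - b j.succ = h j e)),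
            γ b := by
  rw [← Finset.sum_fiberwise_of_maps_to
    (g := fun (f : Fin (m + 1) → ι → A) (j : Fin m) => f j.castSucc - f j.succ)
    (t := Finset.univ.filter (fun h : Fin m → ι → A => ∀ j : Fin m, h j ∈ ℋ))
    (fun f hf => by simpa using (Finset.mem_filter.mp hf).2.2)]
  refine Finset.sum_congr rfl fun h hh => ?_
  rw [Finset.prod_univ_sum]
  refine Finset.sum_bij' (fun f _ e j => f j e) (fun p _ j e => p e j) ?_ ?_
    (fun _ _ => rfl) (fun _ _ => rfl) (fun _ _ => rfl)
  · intro f hf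
    simp only [Finset.mem_filter, Finset.mem_univ, true_and] at hf
    obtain ⟨⟨hB, -⟩, rfl⟩ := hf
    simpa using fun e j => hB j e
  · intro p hp
    simp only [Fintype.mem_piFinset, Finset.mem_filter, Finset.mem_univ, true_and] at hp hh ⊢
    have hdiff : (fun (j : Fin m) => (fun e => p e j.castSucc) - fun e => p e j.succ) = h :=
      funext fun j => funext fun e => (hp e).2 j
    exact ⟨⟨fun j e => (hp e).1 j, fun j => congrFun hdiff j ▸ hh j⟩, hdiff⟩
end

section
/- Let σ be an integer greater than 1, ω a primitive σ-th root of unity in ℂ, F a finite field with q = |F| elements, E a finite set, and G a matrix over F with columns indexed by E, of rank r. For k = 0, 1, …, σ−1, let 𝒪(k,σ) be the set of pairs (f, g) of functions f, g : E → F such that f − g is a flow of G and |supp(f − g)| ≡ k mod σ. Then Σ_{k=0}^{σ−1} ω^k |𝒪(k,σ)| = ω^{|E|−r} (1 − ω)^r q^{|E|} R(M(G); qω/(1−ω), (1−ω)/ω). -/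
open Finset

/-- The row vectors in the row space of `G` vanishing on `B` number `q ^ (r - rk B)`, where `r` is
the rank of `G` and `rk B` that of its columns indexed by `B`. -/
theorem card_rowSpace_vanishing {F : Type*} [Field F] [Fintype F] [DecidableEq F]
    {ι : Type*} [Fintype ι] [DecidableEq ι] {n : ℕ} (G : Matrix (Fin n) ι F)
    (p : (ι → F) → Prop) [DecidablePred p]
    (hp : ∀ h, p h ↔ h ∈ Submodule.span F (Set.range G.row)) (B : Finset ι) :
    (univ.filter fun h : ι → F => p h ∧ ∀ e ∈ B, h e = 0).card =
      Fintype.card F ^ (G.rank - (G.submatrix id ((↑) : B → ι)).rank) := by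
  set C := Submodule.span F (Set.range G.row)
  let ρ : (ι → F) →ₗ[F] (B → F) := LinearMap.funLeft F F (↑)
  have hrange : LinearMap.range (ρ.domRestrict C) =
      Submodule.span F (Set.range (G.submatrix id ((↑) : B → ι)).row) := by
    rw [LinearMap.range_domRestrict, Submodule.map_span, ← Set.range_comp]
    rfl
  have hdim := (ρ.domRestrict C).finrank_range_add_finrank_ker
  have hC : Module.finrank F C = G.rank := (G.rank_eq_finrank_span_row).symm
  rw [hrange, ← Matrix.rank_eq_finrank_span_row, hC] at hdim
  rw [← hdim, Nat.add_sub_cancel_left, ← Nat.card_eq_fintype_card (α := F),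
    ← Module.natCard_eq_pow_finrank (K := F) (V := LinearMap.ker (ρ.domRestrict C)),
    ← Fintype.card_subtype, ← Nat.card_eq_fintype_card]
  refine Nat.card_congr
    { toFun := fun h => ⟨⟨h.1, (hp _).1 h.2.1⟩, LinearMap.mem_ker.2 <| by
        ext e; exact h.2.2 e e.2⟩
      invFun := fun h => ⟨h.1.1, (hp _).2 h.1.2, fun e he =>
        congrFun (LinearMap.mem_ker.1 h.2) ⟨e, he⟩⟩
      left_inv := fun _ => rfl
      right_inv := fun _ => rfl }

/-- The rank of a set of columns, as the dimension of their span. -/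
theorem finrank_span_columns_image {F : Type*} [Field F] {ι : Type*} {n : ℕ}
    (G : Matrix (Fin n) ι F) (B : Finset ι) :
    Module.finrank F (Submodule.span F ((fun e => fun i => G i e) '' (B : Set ι))) =
      (G.submatrix id ((↑) : B → ι)).rank := by
  rw [Matrix.rank_eq_finrank_span_cols, Set.image_eq_range]
  rfl

/-- Inclusion-exclusion expansion of `w ^ |supp h|` over the subsets of the zero set of `h`. -/
theorem pow_card_support_eq_sum {R : Type*} [CommRing R] {F : Type*} [Zero F] [DecidableEq F]
    {ι : Type*} [Fintype ι] [DecidableEq ι] (w : R) (h : ι → F) :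
    w ^ (univ.filter fun e => h e ≠ 0).card =
      ∑ B : Finset ι, if ∀ e ∈ B, h e = 0 then
        (1 - w) ^ B.card * w ^ (Fintype.card ι - B.card) else 0 := by
  have hfactor : w ^ (univ.filter fun e => h e ≠ 0).card =
      ∏ e, ((if h e = 0 then 1 - w else 0) + w) := by
    rw [← prod_const, prod_filter]
    exact prod_congr rfl fun e _ => by by_cases he : h e = 0 <;> simp [he]
  rw [hfactor, prod_add, powerset_univ]
  refine sum_congr rfl fun B _ => ?_
  rw [prod_ite_zero, prod_const, prod_const, ite_mul, zero_mul,
    card_sdiff_of_subset (subset_univ B), card_univ]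
  congr

/-- Pairs whose difference satisfies `p`, counted by their difference. -/
theorem sum_filter_sub {V R : Type*} [AddCommGroup V] [Fintype V] [CommRing R]
    (p : V → Prop) [DecidablePred p] (f : V → R) :
    ∑ x ∈ univ.filter (fun x : V × V => p (x.1 - x.2)), f (x.1 - x.2) =
      Fintype.card V * ∑ v ∈ univ.filter p, f v := by
  rw [sum_filter, sum_filter, Fintype.sum_prod_type_right]
  simp_rw [fun y => Fintype.sum_equiv (Equiv.subRight y)
    (fun x => if p (x - y) then f (x - y) else 0) (fun v => if p v then f v else 0) fun _ => rfl]
  simp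

/-- Grouping by residues modulo the order of a root of unity. -/
theorem sum_range_pow_mul_card_filter_mod {R α : Type*} [CommRing R] [Fintype α]
    {σ : ℕ} (hσ : 0 < σ) {ω : R} (hω : ω ^ σ = 1) (p : α → Prop) [DecidablePred p] (m : α → ℕ) :
    ∑ k ∈ range σ, ω ^ k * ((univ.filter fun x => p x ∧ m x % σ = k).card : R) =
      ∑ x ∈ univ.filter p, ω ^ m x := by
  rw [← sum_fiberwise_of_maps_to (s := univ.filter p) (t := range σ) (g := fun x => m x % σ)
    fun x _ => mem_range.2 (Nat.mod_lt _ hσ)]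
  refine sum_congr rfl fun k _ => ?_
  rw [filter_filter, mul_comm, ← nsmul_eq_mul, ← sum_const]
  refine sum_congr rfl fun x hx => ?_
  rw [← (mem_filter.1 hx).2.2, ← pow_eq_pow_mod _ hω]

/-- **Theorem 3.1.** Parcels defined by Hamming distance congruence classes:
`Σ_{k=0}^{σ−1} ω^k |𝒪(k,σ)| = ω^{|E|−r} (1−ω)^r q^{|E|} R(M(G); qω/(1−ω), (1−ω)/ω)`. -/
theorem stmt_4
    {F : Type*} [Field F] [Fintype F] [DecidableEq F]
    {ι : Type*} [Fintype ι] [DecidableEq ι]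
    {n : ℕ} (G : Fin n → ι → F)
    (q : ℕ) (hq : q = Fintype.card F)
    (rk : Finset ι → ℕ)
    (hrk : ∀ B : Finset ι,
      rk B = Module.finrank F (Submodule.span F ((fun e => fun i => G i e) '' (B : Set ι))))
    (r : ℕ) (hr : r = rk Finset.univ)
    (Flow : (ι → F) → Prop) [DecidablePred Flow]
    (hFlow : ∀ h : ι → F, Flow h ↔ h ∈ Submodule.span F (Set.range G))
    (σ : ℕ) (hσ : 1 < σ)
    (ω : ℂ) (hω : ω ^ σ = 1) (hωprim : ∀ j : ℕ, 0 < j → j < σ → ω ^ j ≠ 1) :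
    ∑ k ∈ Finset.range σ, ω ^ k *
        ((Finset.univ.filter (fun p : (ι → F) × (ι → F) =>
          Flow (p.1 - p.2) ∧
            (Finset.univ.filter (fun e => (p.1 - p.2) e ≠ 0)).card % σ = k)).card : ℂ)
      = ω ^ (Fintype.card ι - r) * (1 - ω) ^ r * (q : ℂ) ^ (Fintype.card ι) *
          ∑ B : Finset ι,
            ((q : ℂ) * ω / (1 - ω)) ^ (r - rk B) * ((1 - ω) / ω) ^ (B.card - rk B) := by
  have hω0 : ω ≠ 0 := by
    rintro rfl
    simp [zero_pow (by omega : σ ≠ 0)] at hω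
  have hω1 : 1 - ω ≠ 0 := sub_ne_zero.2 fun h => hωprim 1 one_pos hσ (by simp [← h])
  let M : Matrix (Fin n) ι F := G
  have hrkM (B : Finset ι) : rk B = (M.submatrix id ((↑) : B → ι)).rank :=
    (hrk B).trans (finrank_span_columns_image M B)
  have hrM : r = M.rank := by
    rw [hr, hrk, coe_univ, Set.image_univ, Matrix.rank_eq_finrank_span_cols]
    rfl
  have hrkr (B : Finset ι) : rk B ≤ r := by
    rw [hr, hrk, hrk]
    exact Submodule.finrank_mono (Submodule.span_mono (Set.image_mono (by simp)))
  have hrkcard (B : Finset ι) : rk B ≤ B.card := by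
    rw [hrkM]
    simpa using (M.submatrix id ((↑) : B → ι)).rank_le_card_width
  have hrι : r ≤ Fintype.card ι := hr ▸ hrkcard univ
  rw [sum_range_pow_mul_card_filter_mod (by omega) hω
      (fun p : (ι → F) × (ι → F) => Flow (p.1 - p.2))
      (fun p => (univ.filter fun e => (p.1 - p.2) e ≠ 0).card),
    sum_filter_sub Flow fun h => ω ^ (univ.filter fun e => h e ≠ 0).card]
  simp_rw [pow_card_support_eq_sum]
  rw [sum_comm, Fintype.card_fun, ← hq, Nat.cast_pow, mul_comm _ ((q : ℂ) ^ _), mul_assoc]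
  congr 1
  rw [mul_sum]
  refine sum_congr rfl fun B _ => ?_
  rw [← sum_filter, filter_filter, sum_const, card_rowSpace_vanishing M Flow hFlow B, ← hrM,
    ← hrkM, ← hq, nsmul_eq_mul, Nat.cast_pow]
  obtain ⟨a, ha⟩ := Nat.exists_eq_add_of_le (hrkr B)
  obtain ⟨b, hb⟩ := Nat.exists_eq_add_of_le (hrkcard B)
  obtain ⟨c, hc⟩ := Nat.exists_eq_add_of_le hrι
  obtain ⟨d, hd⟩ := Nat.exists_eq_add_of_le (card_le_univ B)
  have hbd : b + d = c + a := by omega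
  rw [show r - rk B = a by omega, show B.card - rk B = b by omega,
    show Fintype.card ι - r = c by omega, show Fintype.card ι - B.card = d by omega, ha, hb,
    div_pow, div_pow, mul_pow]
  field_simp
  have hω_pow : ω ^ b * ω ^ d = ω ^ c * ω ^ a := by rw [← pow_add, ← pow_add, hbd]
  simp only [pow_add]
  linear_combination
    (q : ℂ) ^ a * (1 - ω) ^ rk B * (1 - ω) ^ b * (1 - ω) ^ a * hω_pow
end

section
/- Let σ be a positive integer, ω a primitive σ-th root of unity in ℂ, F a finite field with q = |F| elements where q ≠ 2, E a finite set, and G a matrix over F with columns indexed by E, of rank r. For k = 0, 1, …, σ−1, let 𝒪^×(k,σ) be the set of pairs (f, g) of functions f, g : E → F \ {0} (nowhere-zero functions) such that f − g is a flow of G and |supp(f − g)| ≡ k mod σ. Then Σ_{k=0}^{σ−1} ω^k |𝒪^×(k,σ)| = ω^{|E|−r} (q−2)^{|E|−r} [(1−ω)q + 2ω − 1]^r R(M(G); ωq(q−2)/((1−ω)q + 2ω − 1), ((1−ω)q + 2ω − 1)/(ω(q−2))). -/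
/-- The subcode of the row space of `G` vanishing on `A` has `q ^ (r - rk A)` elements. -/
lemma card_rowSpan_vanishing_on {F : Type*} [Field F] [Fintype F] {ι : Type*} [Fintype ι]
    {m : Type*} [Fintype m] (G : m → ι → F) (A : Finset ι) :
    Nat.card {h : ι → F // h ∈ Submodule.span F (Set.range G) ∧ ∀ e ∈ A, h e = 0} =
      Fintype.card F ^
        (Module.finrank F (Submodule.span F ((fun e => fun i => G i e) '' (Set.univ : Set ι))) -
          Module.finrank F (Submodule.span F ((fun e => fun i => G i e) '' (A : Set ι)))) := by
  classical
  set C := Submodule.span F (Set.range G) with hC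
  let ρ : (ι → F) →ₗ[F] (A → F) := LinearMap.funLeft F F (Subtype.val : A → ι)
  have hCdim : Module.finrank F C =
      Module.finrank F (Submodule.span F ((fun e => fun i => G i e) '' (Set.univ : Set ι))) := by
    rw [Set.image_univ]
    exact (Matrix.rank_eq_finrank_span_row (Matrix.of G)).symm.trans (Matrix.rank_eq_finrank_span_cols (Matrix.of G))
  have hrange : Module.finrank F (LinearMap.range (ρ.domRestrict C)) =
      Module.finrank F (Submodule.span F ((fun e => fun i => G i e) '' (A : Set ι))) := by
    let S : m → A → F := fun i e => G i e
    have hmap : LinearMap.range (ρ.domRestrict C) = Submodule.span F (Set.range S) := by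
      rw [LinearMap.range_domRestrict, hC, Submodule.map_span, ← Set.range_comp]
      rfl
    have hcol : (fun e => fun i => G i e) '' (A : Set ι) = Set.range (fun (e : A) i => S i e) := by
      ext v
      simp [S]
    rw [hmap, hcol]
    exact (Matrix.rank_eq_finrank_span_row (Matrix.of S)).symm.trans (Matrix.rank_eq_finrank_span_cols (Matrix.of S))
  have hker := LinearMap.finrank_range_add_finrank_ker (ρ.domRestrict C)
  have hcard : Nat.card {h : ι → F // h ∈ C ∧ ∀ e ∈ A, h e = 0} =
      Nat.card (LinearMap.ker (ρ.domRestrict C)) := by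
    refine Nat.card_congr
      { toFun := fun h => ⟨⟨h.1, h.2.1⟩, ?_⟩
        invFun := fun h => ⟨h.1.1, h.1.2, ?_⟩
        left_inv := fun _ => rfl
        right_inv := fun _ => rfl }
    · rw [LinearMap.mem_ker]
      ext e
      exact h.2.2 e e.2
    · intro e he
      exact congrFun (LinearMap.mem_ker.mp h.2) ⟨e, he⟩
  rw [hcard, Module.natCard_eq_pow_finrank (K := F), Nat.card_eq_fintype_card]
  congr 1
  omega

/-- For each difference `h`, the number of pairs of nowhere-zero functions with difference `h`. -/
lemma card_nowhereZero_pairs_sub_eq {F : Type*} [Field F] [Fintype F] [DecidableEq F]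
    {ι : Type*} [Fintype ι] [DecidableEq ι] (h : ι → F) :
    ((Finset.univ.filter (fun p : (ι → F) × (ι → F) =>
        ((∀ e, p.1 e ≠ 0) ∧ (∀ e, p.2 e ≠ 0)) ∧ p.1 - p.2 = h)).card : ℂ) =
      ∏ e, (if h e = 0 then (Fintype.card F : ℂ) - 1 else (Fintype.card F : ℂ) - 2) := by
  have hpi : (Finset.univ.filter (fun p : (ι → F) × (ι → F) =>
        ((∀ e, p.1 e ≠ 0) ∧ (∀ e, p.2 e ≠ 0)) ∧ p.1 - p.2 = h)).card =
      (Fintype.piFinset fun e => (Finset.univ : Finset F) \ {0, h e}).card := by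
    refine Finset.card_nbij' (fun p => p.1) (fun f => (f, f - h)) ?_ ?_ ?_ ?_
    · rintro ⟨f, g⟩ hp
      simp only [Finset.coe_filter, Finset.mem_univ, true_and, Set.mem_ofPred_eq] at hp
      obtain ⟨⟨hf, hg⟩, rfl⟩ := hp
      simp [hf, eq_comm (b := f _ - g _), sub_eq_self, hg]
    · intro f hf
      simp only [Finset.mem_coe, Fintype.mem_piFinset, Finset.mem_sdiff, Finset.mem_univ,
        Finset.mem_insert, Finset.mem_singleton, not_or, true_and] at hf
      simp [sub_eq_zero, fun e => (hf e).1, fun e => (hf e).2]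
    · rintro ⟨f, g⟩ hp
      simp only [Finset.coe_filter, Finset.mem_univ, true_and, Set.mem_ofPred_eq] at hp
      simp [← hp.2]
    · intro f _
      rfl
  rw [hpi, Fintype.card_piFinset, Nat.cast_prod]
  refine Finset.prod_congr rfl fun e _ => ?_
  rw [Finset.cast_card_sdiff (Finset.subset_univ _), Finset.card_univ]
  by_cases he : h e = 0
  · simp [he]
  · rw [if_neg he, Finset.card_pair (Ne.symm he)]
    norm_num

/-- Expansion of a two-valued product over the sets of zeros of `h`. -/
lemma prod_ite_eq_zero_expand {F : Type*} [Zero F] [DecidableEq F]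
    {ι : Type*} [Fintype ι] [DecidableEq ι] {R : Type*} [CommRing R] (h : ι → F) (x y : R) :
    ∏ e, (if h e = 0 then x else y) =
      ∑ A : Finset ι, if ∀ e ∈ A, h e = 0 then (x - y) ^ A.card * y ^ (Fintype.card ι - A.card)
        else 0 := by
  have hsplit : ∀ e, (if h e = 0 then x else y) = (if h e = 0 then x - y else 0) + y := by
    intro e
    split_ifs <;> ring
  simp_rw [hsplit]
  rw [Finset.prod_add, Finset.powerset_univ]
  refine Finset.sum_congr rfl fun A _ => ?_
  rw [Finset.prod_const, Finset.card_univ_sdiff, Finset.prod_ite_zero, Finset.prod_const, ite_mul,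
    zero_mul]
  congr

/-- Collecting counts by residue of a statistic `w` modulo the order of a root of unity. -/
lemma sum_pow_mul_card_mod_eq {α : Type*} (s : Finset α) (w : α → ℕ) {R : Type*} [CommRing R]
    {σ : ℕ} (hσ : 0 < σ) {ω : R} (hω : ω ^ σ = 1) :
    ∑ k ∈ Finset.range σ, ω ^ k * ((s.filter fun a => w a % σ = k).card : R) =
      ∑ a ∈ s, ω ^ w a := by
  have hmaps : ∀ a ∈ s, w a % σ ∈ Finset.range σ := fun a _ =>
    Finset.mem_range.mpr (Nat.mod_lt _ hσ)
  rw [← Finset.sum_fiberwise_of_maps_to hmaps]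
  refine Finset.sum_congr rfl fun k _ => ?_
  rw [mul_comm, ← nsmul_eq_mul, ← Finset.sum_const]
  refine Finset.sum_congr rfl fun a ha => ?_
  rw [← (Finset.mem_filter.mp ha).2, ← pow_mod_orderOf ω (w a), ← pow_mod_orderOf ω (w a % σ),
    Nat.mod_mod_of_dvd _ (orderOf_dvd_of_pow_eq_one hω)]

/-- **Theorem 3.3.** Parcels of pairs of nowhere-zero functions defined by Hamming
distance congruence classes. -/
theorem stmt_5
    {F : Type*} [Field F] [Fintype F] [DecidableEq F]
    {ι : Type*} [Fintype ι] [DecidableEq ι]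
    {n : ℕ} (G : Fin n → ι → F)
    (q : ℕ) (hq : q = Fintype.card F) (hq2 : q ≠ 2)
    (rk : Finset ι → ℕ)
    (hrk : ∀ B : Finset ι,
      rk B = Module.finrank F (Submodule.span F ((fun e => fun i => G i e) '' (B : Set ι))))
    (r : ℕ) (hr : r = rk Finset.univ)
    (Flow : (ι → F) → Prop) [DecidablePred Flow]
    (hFlow : ∀ h : ι → F, Flow h ↔ h ∈ Submodule.span F (Set.range G))
    (σ : ℕ) (hσ : 0 < σ)
    (ω : ℂ) (hω : ω ^ σ = 1) (hωprim : ∀ j : ℕ, 0 < j → j < σ → ω ^ j ≠ 1) :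
    ∑ k ∈ Finset.range σ, ω ^ k *
        ((Finset.univ.filter (fun p : (ι → F) × (ι → F) =>
          (∀ e : ι, p.1 e ≠ 0) ∧ (∀ e : ι, p.2 e ≠ 0) ∧ Flow (p.1 - p.2) ∧
            (Finset.univ.filter (fun e => (p.1 - p.2) e ≠ 0)).card % σ = k)).card : ℂ)
      = ω ^ (Fintype.card ι - r) * ((q : ℂ) - 2) ^ (Fintype.card ι - r) *
          ((1 - ω) * q + 2 * ω - 1) ^ r *
          ∑ B : Finset ι,
            (ω * q * ((q : ℂ) - 2) / ((1 - ω) * q + 2 * ω - 1)) ^ (r - rk B) *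
              (((1 - ω) * q + 2 * ω - 1) / (ω * ((q : ℂ) - 2))) ^ (B.card - rk B) := by
  classical
  have hq1 : 1 < q := hq ▸ Fintype.one_lt_card
  have hωnorm : ‖ω‖ = 1 := Complex.norm_eq_one_of_pow_eq_one hω hσ.ne'
  have hω0 : ω ≠ 0 := norm_ne_zero_iff.mp (by rw [hωnorm]; exact one_ne_zero)
  have hq20 : (q : ℂ) - 2 ≠ 0 := by
    rw [sub_ne_zero]
    exact_mod_cast hq2
  set y : ℂ := ω * ((q : ℂ) - 2) with hy
  set u : ℂ := (1 - ω) * q + 2 * ω - 1 with hu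
  have hy0 : y ≠ 0 := mul_ne_zero hω0 hq20
  have hxy : (q : ℂ) - 1 - y = u := by rw [hy, hu]; ring
  have hu0 : u ≠ 0 := by
    intro h0
    have heq : ((q - 1 : ℕ) : ℂ) = ω * ((q - 2 : ℕ) : ℂ) := by
      rw [Nat.cast_sub hq1.le, Nat.cast_sub (by omega : 2 ≤ q)]
      push_cast
      rw [← hxy] at h0
      exact sub_eq_zero.mp h0
    have hn := congrArg norm heq
    rw [norm_mul, hωnorm, one_mul, Complex.norm_natCast, Complex.norm_natCast, Nat.cast_inj] at hn
    omega
  have hrank : ∀ B : Finset ι, rk B ≤ r ∧ rk B ≤ B.card := by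
    intro B
    constructor
    · rw [hr, hrk, hrk]
      exact Submodule.finrank_mono (Submodule.span_mono (Set.image_mono (by simp)))
    · rw [hrk, ← Finset.coe_image]
      exact (finrank_span_finset_le_card _).trans Finset.card_image_le
  have hrι : r ≤ Fintype.card ι := hr ▸ (hrank Finset.univ).2
  have hcount : ∀ A : Finset ι,
      (Finset.univ.filter fun h : ι → F => Flow h ∧ ∀ e ∈ A, h e = 0).card = q ^ (r - rk A) := by
    intro A
    have hA := card_rowSpan_vanishing_on G A
    rw [hr, hrk, hrk, hq, Finset.coe_univ]
    refine Eq.trans ?_ hA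
    rw [Nat.card_eq_fintype_card, Fintype.card_subtype]
    congr 1
    ext h
    simp only [Finset.mem_filter, Finset.mem_univ, true_and, hFlow]
  have hlhs : ∑ k ∈ Finset.range σ, ω ^ k *
        ((Finset.univ.filter (fun p : (ι → F) × (ι → F) =>
          (∀ e : ι, p.1 e ≠ 0) ∧ (∀ e : ι, p.2 e ≠ 0) ∧ Flow (p.1 - p.2) ∧
            (Finset.univ.filter (fun e => (p.1 - p.2) e ≠ 0)).card % σ = k)).card : ℂ) =
      ∑ h : ι → F with Flow h, ∏ e, (if h e = 0 then (q : ℂ) - 1 else y) := by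
    have hsets : ∀ k, (Finset.univ.filter (fun p : (ι → F) × (ι → F) =>
          (∀ e : ι, p.1 e ≠ 0) ∧ (∀ e : ι, p.2 e ≠ 0) ∧ Flow (p.1 - p.2) ∧
            (Finset.univ.filter (fun e => (p.1 - p.2) e ≠ 0)).card % σ = k)) =
        (Finset.univ.filter (fun p : (ι → F) × (ι → F) =>
          ((∀ e : ι, p.1 e ≠ 0) ∧ (∀ e : ι, p.2 e ≠ 0)) ∧ Flow (p.1 - p.2))).filter
            (fun p => (Finset.univ.filter (fun e => (p.1 - p.2) e ≠ 0)).card % σ = k) := by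
      intro k
      ext p
      simp only [Finset.mem_filter, Finset.mem_univ, true_and, and_assoc]
    simp_rw [hsets]
    rw [sum_pow_mul_card_mod_eq _ _ hσ hω]
    have hmaps : ∀ p ∈ Finset.univ.filter (fun p : (ι → F) × (ι → F) =>
          ((∀ e : ι, p.1 e ≠ 0) ∧ (∀ e : ι, p.2 e ≠ 0)) ∧ Flow (p.1 - p.2)),
        p.1 - p.2 ∈ Finset.univ.filter Flow := by
      intro p hp
      exact Finset.mem_filter.mpr ⟨Finset.mem_univ _, (Finset.mem_filter.mp hp).2.2⟩
    rw [← Finset.sum_fiberwise_of_maps_to hmaps]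
    refine Finset.sum_congr rfl fun h hh => ?_
    have hfib : (Finset.univ.filter (fun p : (ι → F) × (ι → F) =>
          ((∀ e : ι, p.1 e ≠ 0) ∧ (∀ e : ι, p.2 e ≠ 0)) ∧ Flow (p.1 - p.2))).filter
            (fun p => p.1 - p.2 = h) =
        Finset.univ.filter (fun p : (ι → F) × (ι → F) =>
          ((∀ e, p.1 e ≠ 0) ∧ (∀ e, p.2 e ≠ 0)) ∧ p.1 - p.2 = h) := by
      ext p
      simp only [Finset.mem_filter, Finset.mem_univ, true_and]
      constructor
      · rintro ⟨⟨hp, -⟩, rfl⟩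
        exact ⟨hp, rfl⟩
      · rintro ⟨hp, rfl⟩
        exact ⟨⟨hp, (Finset.mem_filter.mp hh).2⟩, rfl⟩
    rw [hfib, Finset.sum_congr rfl (g := fun _ =>
      ω ^ (Finset.univ.filter fun e => h e ≠ 0).card)
      (fun p hp => by rw [(Finset.mem_filter.mp hp).2.2]), Finset.sum_const, nsmul_eq_mul,
      card_nowhereZero_pairs_sub_eq, ← hq, ← Finset.prod_const, Finset.prod_filter,
      ← Finset.prod_mul_distrib]
    refine Finset.prod_congr rfl fun e _ => ?_
    by_cases he : h e = 0
    · simp [he]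
    · simp [he, hy, mul_comm]
  rw [hlhs]
  simp_rw [prod_ite_eq_zero_expand, hxy]
  rw [Finset.sum_comm, Finset.mul_sum]
  refine Finset.sum_congr rfl fun A _ => ?_
  rw [← Finset.sum_filter, Finset.filter_filter, Finset.sum_const, hcount, nsmul_eq_mul]
  obtain ⟨hAr, hAc⟩ := hrank A
  have hAι : A.card ≤ Fintype.card ι := A.card_le_univ
  have hqy : ω * q * ((q : ℂ) - 2) = q * y := by rw [hy]; ring
  rw [hqy, ← mul_pow, ← hy]
  clear_value y u
  obtain ⟨a, ha⟩ := Nat.exists_eq_add_of_le hAr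
  obtain ⟨b, hb⟩ := Nat.exists_eq_add_of_le hAc
  obtain ⟨c, hc⟩ := Nat.exists_eq_add_of_le hrι
  obtain ⟨d, hd⟩ := Nat.exists_eq_add_of_le hAι
  have hbd : b + d = a + c := by omega
  have hra : r - rk A = a := by omega
  have hcb : A.card - rk A = b := by omega
  have hιc : Fintype.card ι - r = c := by omega
  have hιd : Fintype.card ι - A.card = d := by omega
  rw [hra, hcb, hιc, hιd, hb, ha, Nat.cast_pow, div_pow, div_pow, mul_pow, pow_add, pow_add]
  have hyy : y ^ b * y ^ d = y ^ a * y ^ c := by rw [← pow_add, ← pow_add, hbd]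
  field_simp
  linear_combination (q : ℂ) ^ a * hyy
end

section
/- Let σ be an integer greater than 1, ρ an integer relatively prime to σ, θ = 2ρπ/σ, and ω = e^{iθ}. Let F be a finite field with q = |F| elements, E a finite set, and G a matrix over F with columns indexed by E, of rank r. For k = 0, 1, …, σ−1, let ℳ_{1,−1}(k,σ) be the set of pairs (f, g) of functions f, g : E → F such that f − g is a flow of G and |supp(f)| − |supp(g)| ≡ k mod σ. Assume (σ, q) is not one of (2,4), (3,3), (4,2) (equivalently, 2cos θ − 2 + q ≠ 0). Then Σ_{k=0}^{σ−1} ω^k |ℳ_{1,−1}(k,σ)| = (2 − 2cos θ)^r (2cos θ − 2 + q)^{|E|−r} R(M(G); q(2cos θ − 2 + q)/(2 − 2cos θ), (2 − 2cos θ)/(2cos θ − 2 + q)). -/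
open Finset

/-- The row space restricted to the columns in `B` has the dimension of their span. -/
theorem finrank_map_restrict_span_range {F ι m : Type*} [Field F] [Finite ι] [Fintype m]
    (G : m → ι → F) (B : Finset ι) :
    Module.finrank F ((Submodule.span F (Set.range G)).map
        (LinearMap.funLeft F F (Subtype.val : B → ι)))
      = Module.finrank F (Submodule.span F ((fun e => fun i => G i e) '' (B : Set ι))) := by
  let A : Matrix m B F := Matrix.of fun i e => G i e
  have hrow := A.rank_eq_finrank_span_row
  have hcol := A.rank_eq_finrank_span_cols
  rw [Submodule.map_span, ← Set.range_comp]
  have himage : (fun e => fun i => G i e) '' (B : Set ι) = Set.range A.col := by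
    rw [Set.image_eq_range]
    rfl
  rw [himage, ← hcol, hrow]
  rfl

theorem finrank_span_range_eq_finrank_span_col {F ι m : Type*} [Field F] [Fintype ι] [Fintype m]
    (G : m → ι → F) :
    Module.finrank F (Submodule.span F (Set.range G))
      = Module.finrank F
          (Submodule.span F ((fun e => fun i => G i e) '' ((univ : Finset ι) : Set ι))) := by
  let A : Matrix m ι F := Matrix.of G
  have hrow := A.rank_eq_finrank_span_row
  have hcol := A.rank_eq_finrank_span_cols
  rw [coe_univ, Set.image_univ]
  exact hrow.symm.trans hcol

/-- The number of vectors of a subspace of `F ^ ι` that vanish on `B`. -/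
theorem card_filter_forall_eq_zero {F ι : Type*} [Field F] [Fintype F] [Fintype ι]
    [DecidableEq ι] (W : Submodule F (ι → F)) (B : Finset ι)
    (P : (ι → F) → Prop) [DecidablePred P] (hP : ∀ h, P h ↔ h ∈ W ∧ ∀ e ∈ B, h e = 0) :
    (univ.filter P).card = Fintype.card F ^ (Module.finrank F W -
        Module.finrank F (W.map (LinearMap.funLeft F F (Subtype.val : B → ι)))) := by
  set L := LinearMap.funLeft F F (Subtype.val : B → ι)
  have hrank := (L.domRestrict W).finrank_range_add_finrank_ker
  rw [LinearMap.range_domRestrict] at hrank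
  rw [← hrank, Nat.add_sub_cancel_left, ← Nat.card_eq_fintype_card,
    ← Module.natCard_eq_pow_finrank (K := F) (V := LinearMap.ker (L.domRestrict W)),
    ← Fintype.card_subtype, ← Nat.card_eq_fintype_card]
  refine Nat.card_congr ⟨fun h => ⟨⟨h.1, ((hP _).1 h.2).1⟩, ?_⟩, fun h => ⟨h.1.1, ?_⟩,
    fun _ => rfl, fun _ => rfl⟩
  · ext e
    exact ((hP _).1 h.2).2 e e.2
  · exact (hP _).2 ⟨h.1.2, fun e he => congrFun h.2 ⟨e, he⟩⟩

theorem sum_pow_mul_card_emod_eq {α K : Type*} [Field K] (s : Finset α) (d : α → ℤ) {σ : ℕ}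
    (hσ : 0 < σ) {ω : K} (hω : ω ^ σ = 1) :
    ∑ k ∈ range σ, ω ^ k * ((s.filter fun p => d p % (σ : ℤ) = (k : ℤ)).card : K)
      = ∑ p ∈ s, ω ^ d p := by
  have hω₀ : ω ≠ 0 := by
    rintro rfl
    simp [hσ.ne'] at hω
  have hσ' : (σ : ℤ) ≠ 0 := by exact_mod_cast hσ.ne'
  simp_rw [card_filter, Nat.cast_sum, mul_sum]
  rw [sum_comm]
  refine sum_congr rfl fun p _ => ?_
  obtain ⟨j, hj⟩ := Int.eq_ofNat_of_zero_le (Int.emod_nonneg (d p) hσ')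
  have hjσ : j < σ := by
    have := Int.emod_lt_of_pos (d p) (by exact_mod_cast hσ : (0 : ℤ) < σ)
    omega
  rw [sum_eq_single j]
  · rw [if_pos hj, Nat.cast_one, mul_one, ← Int.mul_ediv_add_emod (d p) σ, zpow_add₀ hω₀, zpow_mul,
      zpow_natCast ω σ, hω, one_zpow, one_mul, hj, zpow_natCast]
  · intro k _ hk
    rw [if_neg (by omega)]
    simp
  · simp [hjσ]

theorem zpow_card_support_sub_card_support {F ι K : Type*} [Zero F] [DecidableEq F] [Fintype ι]
    [Field K] {ω : K} (hω : ω ≠ 0) (f g : ι → F) :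
    ω ^ (((univ.filter fun e => f e ≠ 0).card : ℤ) - ((univ.filter fun e => g e ≠ 0).card : ℤ))
      = ∏ e, ((if f e = 0 then 1 else ω) * (if g e = 0 then 1 else ω⁻¹)) := by
  rw [zpow_sub₀ hω, zpow_natCast, zpow_natCast, prod_mul_distrib, prod_ite, prod_ite]
  simp [div_eq_mul_inv]

theorem sum_weight_add_mul_weight {F K : Type*} [AddGroup F] [Fintype F] [DecidableEq F] [Field K]
    {ω : K} (hω : ω ≠ 0) (a : F) :
    ∑ y, ((if a + y = 0 then 1 else ω) * (if y = 0 then 1 else ω⁻¹))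
      = (if a = 0 then 2 - (ω + ω⁻¹) else 0) + (ω + ω⁻¹ - 2 + (Fintype.card F : K)) := by
  have hterm : ∀ y : F, ((if a + y = 0 then 1 else ω) * (if y = 0 then 1 else ω⁻¹))
      = 1 + (if y = -a then ω⁻¹ - 1 else 0) + (if y = 0 then ω - 1 else 0)
        + (if y = 0 then (if a = 0 then 2 - (ω + ω⁻¹) else 0) else 0) := by
    intro y
    have hy : a + y = 0 ↔ y = -a := add_eq_zero_iff_eq_neg'
    simp only [hy]
    by_cases h₀ : y = 0
    · subst h₀
      by_cases ha : a = 0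
      · simp only [ha, neg_zero, if_true]
        ring
      · simp [ha]
    · by_cases h₁ : y = -a
      · simp [h₁ ▸ h₀, h₁]
      · simp [h₀, h₁, hω]
  simp_rw [hterm, sum_add_distrib]
  simp
  ring

/-- The generating function of pairs differing by a flow, as a sum over edge sets. -/
theorem sum_zpow_card_support_sub_card_support {F ι K : Type*} [AddCommGroup F] [Fintype F]
    [DecidableEq F] [Fintype ι] [DecidableEq ι] [Field K] {ω : K} (hω : ω ≠ 0)
    (P : (ι → F) → Prop) [DecidablePred P] :
    ∑ p ∈ univ.filter (fun p : (ι → F) × (ι → F) => P (p.1 - p.2)),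
        ω ^ (((univ.filter fun e => p.1 e ≠ 0).card : ℤ)
          - ((univ.filter fun e => p.2 e ≠ 0).card : ℤ))
      = ∑ B : Finset ι, (2 - (ω + ω⁻¹)) ^ B.card
          * (ω + ω⁻¹ - 2 + (Fintype.card F : K)) ^ (Fintype.card ι - B.card)
          * ((univ.filter fun h : ι → F => P h ∧ ∀ e ∈ B, h e = 0).card : K) := by
  have hpairs : ∑ p ∈ univ.filter (fun p : (ι → F) × (ι → F) => P (p.1 - p.2)),
        ω ^ (((univ.filter fun e => p.1 e ≠ 0).card : ℤ)
          - ((univ.filter fun e => p.2 e ≠ 0).card : ℤ))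
      = ∑ h ∈ univ.filter P, ∑ g : ι → F,
          ∏ e, ((if h e + g e = 0 then 1 else ω) * (if g e = 0 then 1 else ω⁻¹)) := by
    rw [← sum_product']
    refine sum_nbij' (fun p => (p.1 - p.2, p.2)) (fun p => (p.1 + p.2, p.2)) ?_ ?_ ?_ ?_ ?_
    · simp
    · simp
    · simp
    · simp
    · intro p _
      rw [zpow_card_support_sub_card_support hω]
      simp
  rw [hpairs]
  have hprod : ∀ h : ι → F, ∑ g : ι → F,
        ∏ e, ((if h e + g e = 0 then 1 else ω) * (if g e = 0 then 1 else ω⁻¹))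
      = ∑ B : Finset ι, if ∀ e ∈ B, h e = 0 then (2 - (ω + ω⁻¹)) ^ B.card
          * (ω + ω⁻¹ - 2 + (Fintype.card F : K)) ^ (Fintype.card ι - B.card) else 0 := by
    intro h
    rw [← Fintype.prod_sum
      fun e y => (if h e + y = 0 then 1 else ω) * (if y = 0 then 1 else ω⁻¹)]
    simp_rw [sum_weight_add_mul_weight hω]
    rw [prod_add, powerset_univ]
    refine sum_congr rfl fun B _ => ?_
    rw [prod_ite_zero, prod_const, prod_const, card_sdiff_of_subset (subset_univ B), card_univ,
      ite_mul, zero_mul]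
    split_ifs <;> rfl
  simp_rw [hprod]
  rw [sum_comm]
  refine sum_congr rfl fun B _ => ?_
  rw [← sum_filter, filter_filter, sum_const, nsmul_eq_mul, mul_comm]

section RationalAngle

variable {σ : ℕ} {ρ : ℤ} {θ : ℝ}

theorem natCast_dvd_of_mul_eq_mul (hρ : Int.gcd ρ (σ : ℤ) = 1) {a b : ℤ}
    (h : a * ρ = σ * b) : (σ : ℤ) ∣ a :=
  (Int.isCoprime_iff_gcd_eq_one.2 hρ).symm.dvd_of_dvd_mul_right ⟨b, h⟩

theorem mul_eq_mul_of_eq_mul_pi (hσ : 0 < σ) (hθ : θ = 2 * (ρ : ℝ) * Real.pi / (σ : ℝ))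
    {a b : ℤ} (h : a * θ = 2 * b * Real.pi) : a * ρ = σ * b := by
  have hσ' : (σ : ℝ) ≠ 0 := by exact_mod_cast hσ.ne'
  rw [hθ] at h
  field_simp at h
  exact_mod_cast (by linarith : (a : ℝ) * ρ = σ * b)

theorem cos_rational_angle_ne_one (hσ : 1 < σ) (hρ : Int.gcd ρ (σ : ℤ) = 1)
    (hθ : θ = 2 * (ρ : ℝ) * Real.pi / (σ : ℝ)) : Real.cos θ ≠ 1 := by
  intro h
  obtain ⟨k, hk⟩ := (Real.cos_eq_one_iff θ).1 h
  have h₁ : (1 : ℤ) * ρ = σ * k :=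
    mul_eq_mul_of_eq_mul_pi (by omega) hθ (by push_cast; linarith)
  have hd := natCast_dvd_of_mul_eq_mul hρ h₁
  have := Int.le_of_dvd one_pos hd
  omega

theorem two_mul_cos_rational_angle_ne {q : ℕ} (hσ : 1 < σ) (hρ : Int.gcd ρ (σ : ℤ) = 1)
    (hθ : θ = 2 * (ρ : ℝ) * Real.pi / (σ : ℝ)) (hq : 1 < q)
    (hexc : ¬ ((σ = 2 ∧ q = 4) ∨ (σ = 3 ∧ q = 3) ∨ (σ = 4 ∧ q = 2))) :
    2 * Real.cos θ - 2 + q ≠ 0 := by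
  intro h
  have hσ₀ : 0 < σ := by omega
  have hq4 : q ≤ 4 := by
    have := Real.neg_one_le_cos θ
    exact_mod_cast (by linarith : (q : ℝ) ≤ 4)
  interval_cases q
  · obtain ⟨k, hk⟩ := Real.cos_eq_zero_iff.1 (show Real.cos θ = 0 by push_cast at h; linarith)
    have h₁ : (4 : ℤ) * ρ = σ * (2 * k + 1) :=
      mul_eq_mul_of_eq_mul_pi hσ₀ hθ (by push_cast; linarith)
    have hd := natCast_dvd_of_mul_eq_mul hρ h₁
    have hle := Int.le_of_dvd (by norm_num) hd
    have hle' : σ ≤ 4 := by omega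
    interval_cases σ <;> omega
  · have hc : Real.cos θ = Real.cos (2 * Real.pi / 3) := by
      rw [show 2 * Real.pi / 3 = Real.pi - Real.pi / 3 by ring, Real.cos_pi_sub,
        Real.cos_pi_div_three]
      push_cast at h
      linarith
    have hd : (σ : ℤ) ∣ 3 := by
      obtain ⟨k, hk | hk⟩ := Real.cos_eq_cos_iff.1 hc
      · exact natCast_dvd_of_mul_eq_mul (b := 1 - 3 * k) hρ
          (mul_eq_mul_of_eq_mul_pi hσ₀ hθ (by push_cast; linarith))
      · exact natCast_dvd_of_mul_eq_mul (b := 3 * k - 1) hρ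
          (mul_eq_mul_of_eq_mul_pi hσ₀ hθ (by push_cast; linarith))
    have hle := Int.le_of_dvd (by norm_num) hd
    have hle' : σ ≤ 3 := by omega
    interval_cases σ <;> omega
  · obtain ⟨k, hk⟩ := Real.cos_eq_neg_one_iff.1
      (show Real.cos θ = -1 by push_cast at h; linarith)
    have h₁ : (2 : ℤ) * ρ = σ * (2 * k + 1) :=
      mul_eq_mul_of_eq_mul_pi hσ₀ hθ (by push_cast; linarith)
    have hd := natCast_dvd_of_mul_eq_mul hρ h₁
    have hle := Int.le_of_dvd (by norm_num) hd
    have hle' : σ ≤ 2 := by omega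
    interval_cases σ
    omega

theorem exp_rational_angle_pow_eq_one (hσ : 0 < σ)
    (hθ : θ = 2 * (ρ : ℝ) * Real.pi / (σ : ℝ)) : Complex.exp (θ * Complex.I) ^ σ = 1 := by
  have hσ' : (σ : ℂ) ≠ 0 := by exact_mod_cast hσ.ne'
  rw [← Complex.exp_nat_mul, Complex.exp_eq_one_iff]
  refine ⟨ρ, ?_⟩
  rw [hθ]
  push_cast
  field_simp

end RationalAngle

theorem exp_mul_I_add_inv (θ : ℝ) :
    Complex.exp (θ * Complex.I) + (Complex.exp (θ * Complex.I))⁻¹ = 2 * (Real.cos θ : ℂ) := by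
  rw [← Complex.exp_neg, Complex.ofReal_cos, Complex.two_cos, neg_mul]

theorem rank_term_eq {K : Type*} [Field K] {s t q : K} (hs : s ≠ 0) (ht : t ≠ 0) {r m b k : ℕ}
    (hkr : k ≤ r) (hrm : r ≤ m) (hkb : k ≤ b) (hbm : b ≤ m) :
    t ^ r * s ^ (m - r) * ((q * s / t) ^ (r - k) * (t / s) ^ (b - k))
      = t ^ b * s ^ (m - b) * q ^ (r - k) := by
  obtain ⟨i, rfl⟩ := Nat.exists_eq_add_of_le hkr
  obtain ⟨j, rfl⟩ := Nat.exists_eq_add_of_le hkb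
  obtain ⟨l, rfl⟩ := Nat.exists_eq_add_of_le hrm
  obtain ⟨c, hc⟩ := Nat.exists_eq_add_of_le hbm
  have h₁ : k + i + l - (k + j) = c := by omega
  have h₂ : s ^ l * s ^ i = s ^ c * s ^ j := by
    rw [← pow_add, ← pow_add]
    congr 1
    omega
  rw [h₁]
  simp only [Nat.add_sub_cancel_left, div_pow, mul_pow, pow_add]
  field_simp
  linear_combination q ^ i * h₂

/-- **Theorem 4.7.** Parcels defined by `|supp(f)| − |supp(g)| ≡ k mod σ`. -/
theorem stmt_8
    {F : Type*} [Field F] [Fintype F] [DecidableEq F]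
    {ι : Type*} [Fintype ι] [DecidableEq ι]
    {n : ℕ} (G : Fin n → ι → F)
    (q : ℕ) (hq : q = Fintype.card F)
    (rk : Finset ι → ℕ)
    (hrk : ∀ B : Finset ι,
      rk B = Module.finrank F (Submodule.span F ((fun e => fun i => G i e) '' (B : Set ι))))
    (r : ℕ) (hr : r = rk Finset.univ)
    (Flow : (ι → F) → Prop) [DecidablePred Flow]
    (hFlow : ∀ h : ι → F, Flow h ↔ h ∈ Submodule.span F (Set.range G))
    (σ : ℕ) (hσ : 1 < σ)
    (ρ : ℤ) (hρ : Int.gcd ρ (σ : ℤ) = 1)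
    (θ : ℝ) (hθ : θ = 2 * (ρ : ℝ) * Real.pi / (σ : ℝ))
    (ω : ℂ) (hω : ω = Complex.exp (θ * Complex.I))
    (hexc : ¬ ((σ = 2 ∧ q = 4) ∨ (σ = 3 ∧ q = 3) ∨ (σ = 4 ∧ q = 2))) :
    ∑ k ∈ Finset.range σ, ω ^ k *
        ((Finset.univ.filter (fun p : (ι → F) × (ι → F) =>
          Flow (p.1 - p.2) ∧
            (((Finset.univ.filter (fun e => p.1 e ≠ 0)).card : ℤ)
              - ((Finset.univ.filter (fun e => p.2 e ≠ 0)).card : ℤ)) % (σ : ℤ)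
              = (k : ℤ))).card : ℂ)
      = (2 - 2 * (Real.cos θ : ℂ)) ^ r
          * (2 * (Real.cos θ : ℂ) - 2 + (q : ℂ)) ^ (Fintype.card ι - r) *
          ∑ B : Finset ι,
            ((q : ℂ) * (2 * (Real.cos θ : ℂ) - 2 + (q : ℂ))
                / (2 - 2 * (Real.cos θ : ℂ))) ^ (r - rk B) *
              ((2 - 2 * (Real.cos θ : ℂ))
                / (2 * (Real.cos θ : ℂ) - 2 + (q : ℂ))) ^ (B.card - rk B) := by
  have hσ₀ : 0 < σ := by omega
  have ht : (2 - 2 * (Real.cos θ : ℂ)) ≠ 0 := by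
    have h := cos_rational_angle_ne_one hσ hρ hθ
    exact_mod_cast (fun h' => h (by linarith) : 2 - 2 * Real.cos θ ≠ 0)
  have hs : (2 * (Real.cos θ : ℂ) - 2 + (q : ℂ)) ≠ 0 := by
    have h := two_mul_cos_rational_angle_ne hσ hρ hθ (hq ▸ Fintype.one_lt_card) hexc
    exact_mod_cast h
  have hω₀ : ω ≠ 0 := hω ▸ Complex.exp_ne_zero _
  have hωσ : ω ^ σ = 1 := hω ▸ exp_rational_angle_pow_eq_one hσ₀ hθ
  have hωinv : ω + ω⁻¹ = 2 * (Real.cos θ : ℂ) := hω ▸ exp_mul_I_add_inv θ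
  have hmap := finrank_map_restrict_span_range G
  have hrank : Module.finrank F (Submodule.span F (Set.range G)) = r := by
    rw [hr, hrk, finrank_span_range_eq_finrank_span_col]
  have hrkr : ∀ B, rk B ≤ r := fun B => by
    rw [hrk, ← hmap, ← hrank]
    exact Submodule.finrank_map_le _ _
  have hrkc : ∀ B : Finset ι, rk B ≤ B.card := fun B => by
    rw [hrk, ← hmap]
    exact (Submodule.finrank_le _).trans_eq (by simp)
  simp_rw [← filter_filter]
  rw [sum_pow_mul_card_emod_eq _ _ hσ₀ hωσ, sum_zpow_card_support_sub_card_support hω₀ Flow,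
    hωinv, ← hq, mul_sum]
  refine sum_congr rfl fun B _ => ?_
  rw [rank_term_eq hs ht (hrkr B) (hr ▸ hrkc univ) (hrkc B) (card_le_univ B),
    card_filter_forall_eq_zero (Submodule.span F (Set.range G)) B _ fun h => by rw [hFlow],
    hmap, hrank, ← hrk, ← hq, Nat.cast_pow]
end

section
/- Let σ be an integer greater than 1, ω a primitive σ-th root of unity in ℂ, F a finite field with q = |F| elements, E a finite set, and G a matrix over F with columns indexed by E, of rank r. For a binary operation ∘ on subsets of E and k = 0,1,…,σ−1, let ℳ^∘(k,σ) be the set of pairs (f,g) of functions f, g : E → F with f − g a flow of G and |supp(f) ∘ supp(g)| ≡ k mod σ. Then: (a) Σ_{k=0}^{σ−1} ω^k |ℳ^∪(k,σ)| = (1−ω)^r (ωq)^{|E|−r} R(M(G); ωq²/(1−ω), (1−ω)/(ωq)); (b) if 2 + ω(q−2) ≠ 0, Σ_{k=0}^{σ−1} ω^k |ℳ^∩(k,σ)| = (ω−1)^r (2 + ω(q−2))^{|E|−r} R(M(G); q(2 + ω(q−2))/(ω−1), (ω−1)/(2 + ω(q−2))); (c) if 2ω + q − 2 ≠ 0, Σ_{k=0}^{σ−1}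 ω^k |ℳ^Δ(k,σ)| = (2 − 2ω)^r (2ω + q − 2)^{|E|−r} R(M(G); q(2ω + q − 2)/(2 − 2ω), (2 − 2ω)/(2ω + q − 2)); (d) Σ_{k=0}^{σ−1} ω^k |ℳ^|(k,σ)| = (ω−1)^r q^{|E|−r} R(M(G); q²/(ω−1), (ω−1)/q); (e) if 1 + ω(q−1) ≠ 0, Σ_{k=0}^{σ−1} ω^k |ℳ^→(k,σ)| = (ω−1)^r (1 + ω(q−1))^{|E|−r} R(M(G); q(1 + ω(q−1))/(ω−1), (ω−1)/(1 + ω(q−1))). Here ∪ is union, ∩ is intersection, Δ is symmetric difference, A | B = E \ (A ∪ B) is the Sheffer stroke, and A → B = (E \ A) ∪ B is implication. -/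
open Finset

/-- The rank of a set of columns is the dimension of the row space restricted to these columns. -/
theorem finrank_map_funLeft_span_range {F ι : Type*} [Field F] {n : ℕ}
    (G : Fin n → ι → F) (B : Finset ι) :
    Module.finrank F ((Submodule.span F (Set.range G)).map
        (LinearMap.funLeft F F (Subtype.val : B → ι))) =
      Module.finrank F (Submodule.span F ((fun e => fun i => G i e) '' (B : Set ι))) := by
  set A : Matrix (Fin n) B F := Matrix.of fun i e => G i e
  have hrow : A.rank = Module.finrank F (Submodule.span F (Set.range A.row)) :=
    A.rank_eq_finrank_span_row
  have hcol : A.rank = Module.finrank F (Submodule.span F (Set.range A.col)) :=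
    A.rank_eq_finrank_span_cols
  rw [Submodule.map_span, ← Set.range_comp]
  have h1 : Set.range (LinearMap.funLeft F F (Subtype.val : B → ι) ∘ G) = Set.range A.row := rfl
  have h2 : (fun e => fun i => G i e) '' (B : Set ι) = Set.range A.col := by
    rw [Set.image_eq_range]
    rfl
  rw [h1, h2, ← hrow, hcol]

/-- The number of vectors of a subspace that vanish on the coordinates in `B`. -/
theorem card_filter_mem_forall_eq_zero {F ι : Type*} [Field F] [Fintype F] [DecidableEq F]
    [Fintype ι] [DecidableEq ι]
    (V : Submodule F (ι → F)) (Flow : (ι → F) → Prop) [DecidablePred Flow]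
    (hFlow : ∀ h, Flow h ↔ h ∈ V) (B : Finset ι) :
    #{h : ι → F | Flow h ∧ ∀ e ∈ B, h e = 0} =
      Fintype.card F ^ (Module.finrank F V - Module.finrank F
        (V.map (LinearMap.funLeft F F (Subtype.val : B → ι)))) := by
  set ρ := (LinearMap.funLeft F F (Subtype.val : B → ι)).domRestrict V
  have hrange : ρ.range = V.map (LinearMap.funLeft F F (Subtype.val : B → ι)) :=
    LinearMap.range_domRestrict _ _
  have hdim := ρ.finrank_range_add_finrank_ker
  rw [hrange] at hdim
  rw [← hdim, Nat.add_sub_cancel_left, ← Nat.card_eq_fintype_card,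
    ← Module.natCard_eq_pow_finrank (K := F) (V := ρ.ker), ← Fintype.card_subtype,
    ← Nat.card_eq_fintype_card]
  refine Nat.card_congr
    ⟨fun h => ⟨⟨h.1, (hFlow _).1 h.2.1⟩, ?_⟩, fun h => ⟨h.1.1, (hFlow _).2 h.1.2, ?_⟩,
      fun _ => rfl, fun _ => rfl⟩
  · rw [LinearMap.mem_ker]
    ext e
    exact h.2.2 e e.2
  · intro e he
    exact congrFun (LinearMap.mem_ker.1 h.2) ⟨e, he⟩

/-- A sum over pairs whose difference is a flow of a product of local weights, when the total weight
of the pairs of field elements with a given difference `c` depends only on whether `c = 0`. -/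
theorem sum_prod_weight_eq {F ι : Type*} [Field F] [Fintype F] [DecidableEq F]
    [Fintype ι] [DecidableEq ι]
    (Flow : (ι → F) → Prop) [DecidablePred Flow] (w : F → F → ℂ) (d b : ℂ)
    (hw : ∀ c, ∑ y, w (c + y) y = (if c = 0 then d else 0) + b) :
    ∑ p : (ι → F) × (ι → F) with Flow (p.1 - p.2), ∏ e, w (p.1 e) (p.2 e) =
      ∑ B : Finset ι, d ^ #B * b ^ (Fintype.card ι - #B) *
        #{h : ι → F | Flow h ∧ ∀ e ∈ B, h e = 0} := by
  have hshift : ∑ p : (ι → F) × (ι → F) with Flow (p.1 - p.2), ∏ e, w (p.1 e) (p.2 e) =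
      ∑ h : ι → F with Flow h, ∏ e, ((if h e = 0 then d else 0) + b) := by
    simp_rw [← hw, Fintype.prod_sum]
    rw [sum_filter, sum_filter, Fintype.sum_prod_type_right]
    have hy : ∀ y : ι → F,
        (∑ x : ι → F, if Flow (x - y) then ∏ e, w (x e) (y e) else 0) =
          ∑ h : ι → F, if Flow h then ∏ e, w (h e + y e) (y e) else 0 := fun y => by
      rw [← Equiv.sum_comp (Equiv.addRight y)]
      simp
    simp_rw [hy]
    rw [sum_comm]
    refine sum_congr rfl fun h _ => ?_
    split_ifs <;> simp
  rw [hshift]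
  simp_rw [Fintype.prod_add, card_filter, Nat.cast_sum, mul_sum]
  rw [sum_comm]
  refine sum_congr rfl fun B _ => ?_
  rw [sum_filter]
  refine sum_congr rfl fun h _ => ?_
  by_cases hF : Flow h <;> simp [hF, prod_ite_zero, card_compl]

/-- The total weight of the pairs with difference `c`, for a weight that only depends on which
entries of the pair are nonzero. -/
theorem sum_weight_add_eq {F : Type*} [Field F] [Fintype F] [DecidableEq F]
    (t : Bool → Bool → ℂ) (c : F) :
    ∑ y, t (c + y ≠ 0) (y ≠ 0) =
      (if c = 0 then t false false + t true true - t false true - t true false else 0) +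
        (t false true + t true false + ((Fintype.card F : ℂ) - 2) * t true true) := by
  have hpt : ∀ y : F, t (c + y ≠ 0) (y ≠ 0) = t true true +
      (if y = 0 then t (c ≠ 0) false - t (c ≠ 0) true else 0) +
      (if y = -c then t false true - t true true else 0) := by
    intro y
    by_cases hy : y = 0
    · subst hy
      by_cases hc : c = 0
      · simp [hc]
        ring
      · simp [hc, eq_comm]
    · have hiff : c + y = 0 ↔ y = -c := by rw [add_comm, add_eq_zero_iff_eq_neg]
      by_cases hc : y = -c
      · subst hc
        simp [neg_ne_zero.1 hy]
      · simp [hy, hiff, hc]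
  simp_rw [hpt, sum_add_distrib, sum_ite_eq']
  by_cases hc : c = 0 <;> simp [hc] <;> ring

/-- Grouping a sum of powers of a root of unity by the residues of the exponents. -/
theorem sum_pow_mul_card_filter_mod {σ : ℕ} (hσ : 0 < σ) {ω : ℂ} (hω : ω ^ σ = 1)
    {α : Type*} [Fintype α] (Q : α → Prop) [DecidablePred Q] (c : α → ℕ) :
    ∑ k ∈ range σ, ω ^ k * (#{p | Q p ∧ c p % σ = k} : ℂ) = ∑ p with Q p, ω ^ c p := by
  rw [← sum_fiberwise_of_maps_to (s := univ.filter Q) (t := range σ) (g := fun p => c p % σ)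
    (fun p _ => mem_range.2 (Nat.mod_lt _ hσ))]
  refine sum_congr rfl fun k _ => ?_
  rw [filter_filter, sum_congr rfl (g := fun _ => ω ^ k), sum_const, nsmul_eq_mul, mul_comm]
  intro p hp
  rw [pow_eq_pow_mod _ hω, (mem_filter.1 hp).2.2]

/-- The parcel generating function of a set operation given pointwise by the Boolean function
`φ`. -/
theorem sum_pow_mul_card_parcel_eq {F ι : Type*} [Field F] [Fintype F] [DecidableEq F]
    [Fintype ι] [DecidableEq ι] {n : ℕ} (G : Fin n → ι → F)
    (rk : Finset ι → ℕ)
    (hrk : ∀ B : Finset ι,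
      rk B = Module.finrank F (Submodule.span F ((fun e => fun i => G i e) '' (B : Set ι))))
    (Flow : (ι → F) → Prop) [DecidablePred Flow]
    (hFlow : ∀ h : ι → F, Flow h ↔ h ∈ Submodule.span F (Set.range G))
    {σ : ℕ} (hσ : 0 < σ) {ω : ℂ} (hω : ω ^ σ = 1)
    (op : Finset ι → Finset ι → Finset ι) (φ : Bool → Bool → Bool)
    (hop : ∀ A B e, e ∈ op A B ↔ φ (e ∈ A) (e ∈ B) = true)
    (t : Bool → Bool → ℂ) (ht : ∀ x y, t x y = if φ x y = true then ω else 1) {d b : ℂ}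
    (hd : d = t false false + t true true - t false true - t true false)
    (hb : b = t false true + t true false + ((Fintype.card F : ℂ) - 2) * t true true)
    (hd0 : d ≠ 0) (hb0 : b ≠ 0) :
    ∑ k ∈ range σ, ω ^ k * (#{p : (ι → F) × (ι → F) | Flow (p.1 - p.2) ∧
        #(op {e | p.1 e ≠ 0} {e | p.2 e ≠ 0}) % σ = k} : ℂ) =
      d ^ rk univ * b ^ (Fintype.card ι - rk univ) *
        ∑ B : Finset ι, ((Fintype.card F : ℂ) * b / d) ^ (rk univ - rk B) *
          (d / b) ^ (#B - rk B) := by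
  have hpow : ∀ p : (ι → F) × (ι → F), ω ^ #(op {e | p.1 e ≠ 0} {e | p.2 e ≠ 0}) =
      ∏ e, t (p.1 e ≠ 0) (p.2 e ≠ 0) := fun p => by
    simp_rw [ht]
    rw [prod_ite, prod_const_one, mul_one, prod_const]
    congr 2
    ext e
    simp [hop]
  rw [sum_pow_mul_card_filter_mod hσ hω]
  simp_rw [hpow]
  rw [sum_prod_weight_eq Flow (fun x y => t (x ≠ 0) (y ≠ 0)) d b
    (fun c => by rw [sum_weight_add_eq, hd, hb]), mul_sum]
  have hfin : Module.finrank F (Submodule.span F (Set.range G)) = rk univ := by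
    have hinj : Function.Injective
        (LinearMap.funLeft F F (Subtype.val : ↥(univ : Finset ι) → ι)) :=
      LinearMap.funLeft_injective_of_surjective F F _ fun e => ⟨⟨e, mem_univ e⟩, rfl⟩
    rw [hrk, ← finrank_map_funLeft_span_range]
    exact (Submodule.equivMapOfInjective _ hinj _).finrank_eq
  have hcard : ∀ B, rk B ≤ #B := fun B => by
    rw [hrk, ← coe_image]
    exact (finrank_span_finset_le_card _).trans card_image_le
  have hmono : ∀ B, rk B ≤ rk univ := fun B => by
    rw [hrk, hrk]
    exact Submodule.finrank_mono (Submodule.span_mono (Set.image_mono (by simp)))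
  refine sum_congr rfl fun B _ => ?_
  rw [card_filter_mem_forall_eq_zero _ Flow hFlow, finrank_map_funLeft_span_range, ← hrk, hfin]
  obtain ⟨u, hu⟩ := Nat.exists_eq_add_of_le (hmono B)
  obtain ⟨v, hv⟩ := Nat.exists_eq_add_of_le (hcard B)
  obtain ⟨m, hm⟩ := Nat.exists_eq_add_of_le (hcard univ)
  obtain ⟨l, hl⟩ := Nat.exists_eq_add_of_le (card_le_univ B)
  rw [card_univ] at hm
  have e1 : Fintype.card ι - #B = l := by omega
  have e2 : Fintype.card ι - rk univ = m := by omega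
  have e3 : l + v = m + u := by omega
  have e4 : b ^ l * b ^ v = b ^ m * b ^ u := by rw [← pow_add, ← pow_add, e3]
  rw [e1, e2, hv, hu, Nat.add_sub_cancel_left, Nat.add_sub_cancel_left, div_pow, div_pow, mul_pow]
  push_cast
  field_simp
  simp only [pow_add]
  linear_combination (d ^ rk B * d ^ v * d ^ u) * e4

/-- **Theorem 4.16.** Parcels defined by a binary set-operation on supports:
union, intersection, symmetric difference, Sheffer stroke, and implication. -/
theorem stmt_12
    {F : Type*} [Field F] [Fintype F] [DecidableEq F]
    {ι : Type*} [Fintype ι] [DecidableEq ι]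
    {n : ℕ} (G : Fin n → ι → F)
    (q : ℕ) (hq : q = Fintype.card F)
    (rk : Finset ι → ℕ)
    (hrk : ∀ B : Finset ι,
      rk B = Module.finrank F (Submodule.span F ((fun e => fun i => G i e) '' (B : Set ι))))
    (r : ℕ) (hr : r = rk Finset.univ)
    (Flow : (ι → F) → Prop) [DecidablePred Flow]
    (hFlow : ∀ h : ι → F, Flow h ↔ h ∈ Submodule.span F (Set.range G))
    (σ : ℕ) (hσ : 1 < σ)
    (ω : ℂ) (hω : ω ^ σ = 1) (hωprim : ∀ j : ℕ, 0 < j → j < σ → ω ^ j ≠ 1)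
    (P : (Finset ι → Finset ι → Finset ι) → ℕ → ℕ)
    (hP : ∀ (op : Finset ι → Finset ι → Finset ι) (k : ℕ),
      P op k = (Finset.univ.filter (fun p : (ι → F) × (ι → F) =>
        Flow (p.1 - p.2) ∧
          (op (Finset.univ.filter (fun e => p.1 e ≠ 0))
              (Finset.univ.filter (fun e => p.2 e ≠ 0))).card % σ = k)).card) :
    (∑ k ∈ Finset.range σ, ω ^ k * (P (fun A B => A ∪ B) k : ℂ)
      = (1 - ω) ^ r * (ω * (q : ℂ)) ^ (Fintype.card ι - r) *
          ∑ B : Finset ι,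
            (ω * (q : ℂ) ^ 2 / (1 - ω)) ^ (r - rk B) *
              ((1 - ω) / (ω * (q : ℂ))) ^ (B.card - rk B)) ∧
    (2 + ω * ((q : ℂ) - 2) ≠ 0 →
      ∑ k ∈ Finset.range σ, ω ^ k * (P (fun A B => A ∩ B) k : ℂ)
        = (ω - 1) ^ r * (2 + ω * ((q : ℂ) - 2)) ^ (Fintype.card ι - r) *
            ∑ B : Finset ι,
              ((q : ℂ) * (2 + ω * ((q : ℂ) - 2)) / (ω - 1)) ^ (r - rk B) *
                ((ω - 1) / (2 + ω * ((q : ℂ) - 2))) ^ (B.card - rk B)) ∧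
    (2 * ω + (q : ℂ) - 2 ≠ 0 →
      ∑ k ∈ Finset.range σ, ω ^ k * (P (fun A B => symmDiff A B) k : ℂ)
        = (2 - 2 * ω) ^ r * (2 * ω + (q : ℂ) - 2) ^ (Fintype.card ι - r) *
            ∑ B : Finset ι,
              ((q : ℂ) * (2 * ω + (q : ℂ) - 2) / (2 - 2 * ω)) ^ (r - rk B) *
                ((2 - 2 * ω) / (2 * ω + (q : ℂ) - 2)) ^ (B.card - rk B)) ∧
    (∑ k ∈ Finset.range σ, ω ^ k * (P (fun A B => Finset.univ \ (A ∪ B)) k : ℂ)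
      = (ω - 1) ^ r * (q : ℂ) ^ (Fintype.card ι - r) *
          ∑ B : Finset ι,
            ((q : ℂ) ^ 2 / (ω - 1)) ^ (r - rk B) *
              ((ω - 1) / (q : ℂ)) ^ (B.card - rk B)) ∧
    (1 + ω * ((q : ℂ) - 1) ≠ 0 →
      ∑ k ∈ Finset.range σ, ω ^ k * (P (fun A B => (Finset.univ \ A) ∪ B) k : ℂ)
        = (ω - 1) ^ r * (1 + ω * ((q : ℂ) - 1)) ^ (Fintype.card ι - r) *
            ∑ B : Finset ι,
              ((q : ℂ) * (1 + ω * ((q : ℂ) - 1)) / (ω - 1)) ^ (r - rk B) *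
                ((ω - 1) / (1 + ω * ((q : ℂ) - 1))) ^ (B.card - rk B)) := by
  have hσ0 : 0 < σ := by omega
  have hω1 : ω - 1 ≠ 0 := sub_ne_zero.2 (by simpa using hωprim 1 one_pos hσ)
  have hω1' : 1 - ω ≠ 0 := by rwa [← neg_sub, neg_ne_zero]
  have hω0 : ω ≠ 0 := by
    rintro rfl
    simp [hσ0.ne'] at hω
  have hq0 : (q : ℂ) ≠ 0 := by
    rw [hq]
    exact Nat.cast_ne_zero.2 Fintype.card_ne_zero
  subst hq hr
  simp_rw [hP]
  have key := fun {d b : ℂ} op φ hop => sum_pow_mul_card_parcel_eq G rk hrk Flow hFlow hσ0 hω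
    op φ hop _ (d := d) (b := b) (fun _ _ => rfl)
  refine ⟨?_, fun h => ?_, fun h => ?_, ?_, fun h => ?_⟩
  · rw [key (fun A B => A ∪ B) (fun x y => x || y) (by simp) (d := 1 - ω) (b := ω * Fintype.card F)
      (by simp) (by simp; ring) hω1' (mul_ne_zero hω0 hq0)]
    congr! 5
    ring
  · exact key (fun A B => A ∩ B) (fun x y => x && y) (by simp) (by simp) (by simp; ring) hω1 h
  · exact key (fun A B => symmDiff A B) (fun x y => xor x y) (by simp [mem_symmDiff]; grind)
      (by simp; ring) (by simp; ring)
      (by rw [← mul_one_sub]; exact mul_ne_zero two_ne_zero hω1') h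
  · rw [key (fun A B => univ \ (A ∪ B)) (fun x y => !(x || y)) (by simp) (d := ω - 1)
      (b := Fintype.card F) (by simp) (by simp; ring) hω1 hq0]
    congr! 5
    ring
  · exact key (fun A B => (univ \ A) ∪ B) (fun x y => !x || y) (by simp) (by simp)
      (by simp; ring) hω1 h
end

section
/- Let m be an integer with m ≥ 2, and let G be a matrix over GF(2) with columns indexed by a finite set E, of rank r. For k = 0, 1, …, 2m+1, let 𝒯_m(k, 2m+2) be the set of (m+1)-tuples (f₁, f₂, …, f_{m+1}) of functions f_j : E → GF(2) such that f_j − f_{j+1} is a flow of G for each 1 ≤ j ≤ m, and Σ_{j=1}^{m+1} |supp(f_j)| ≡ k mod 2m+2. Then Σ_{k=0}^{2m+1} e^{kπi/(m+1)} |𝒯_m(k, 2m+2)| ≠ 0 if and only if χ(M(G); 2^m) ≠ 0. -/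
open Finset

/-- The dimension of the subspace of row-space vectors vanishing on `B`. -/
theorem finrank_rowSpace_vanishing {ι : Type*} [Fintype ι] {n : ℕ} (G : Fin n → ι → ZMod 2)
    (B : Finset ι) :
    Module.finrank (ZMod 2)
        (Submodule.span (ZMod 2) ((fun e => fun i => G i e) '' (B : Set ι))) +
      Module.finrank (ZMod 2) (LinearMap.ker
        ((LinearMap.funLeft (ZMod 2) (ZMod 2) (Subtype.val : B → ι)).domRestrict
          (Submodule.span (ZMod 2) (Set.range G)))) =
      Module.finrank (ZMod 2) (Submodule.span (ZMod 2) (Set.range G)) := by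
  rw [← LinearMap.finrank_range_add_finrank_ker
    ((LinearMap.funLeft (ZMod 2) (ZMod 2) (Subtype.val : B → ι)).domRestrict
      (Submodule.span (ZMod 2) (Set.range G)))]
  congr 1
  rw [LinearMap.range_domRestrict, Submodule.map_span, ← Set.range_comp]
  let A : Matrix (Fin n) B (ZMod 2) := Matrix.of fun i e => G i e
  have hrow : Set.range ((LinearMap.funLeft (ZMod 2) (ZMod 2) (Subtype.val : B → ι)) ∘ G) =
      Set.range A.row := rfl
  have hcol : (fun e => fun i => G i e) '' (B : Set ι) = Set.range A.col := by
    rw [Set.image_eq_range]; rfl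
  rw [hrow, hcol, ← Matrix.rank_eq_finrank_span_row, ← Matrix.rank_eq_finrank_span_cols]

theorem card_rowSpace_vanishing_s15 {ι : Type*} [Fintype ι] {n : ℕ}
    (G : Fin n → ι → ZMod 2) (B : Finset ι)
    [Fintype {h : Submodule.span (ZMod 2) (Set.range G) // ∀ e ∈ B, h.1 e = 0}] :
    Fintype.card {h : Submodule.span (ZMod 2) (Set.range G) // ∀ e ∈ B, h.1 e = 0} =
      2 ^ (Module.finrank (ZMod 2) (Submodule.span (ZMod 2) (Set.range G)) -
        Module.finrank (ZMod 2)
          (Submodule.span (ZMod 2) ((fun e => fun i => G i e) '' (B : Set ι)))) := by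
  rw [← finrank_rowSpace_vanishing G B, Nat.add_sub_cancel_left, ← Nat.card_eq_fintype_card]
  have h := Module.natCard_eq_pow_finrank (K := ZMod 2) (V := LinearMap.ker
        ((LinearMap.funLeft (ZMod 2) (ZMod 2) (Subtype.val : B → ι)).domRestrict
          (Submodule.span (ZMod 2) (Set.range G))))
  rw [Nat.card_zmod] at h
  rw [← h]
  refine Nat.card_congr (Equiv.subtypeEquivRight fun x => ?_)
  simp [funext_iff, LinearMap.funLeft_apply]

theorem finrank_rowSpace_eq {ι : Type*} [Fintype ι] {n : ℕ} (G : Fin n → ι → ZMod 2) :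
    Module.finrank (ZMod 2) (Submodule.span (ZMod 2) (Set.range G)) =
      Module.finrank (ZMod 2) (Submodule.span (ZMod 2)
        ((fun e => fun i => G i e) '' ((Finset.univ : Finset ι) : Set ι))) := by
  let A : Matrix (Fin n) ι (ZMod 2) := Matrix.of G
  have hcol : (fun e => fun i => G i e) '' ((Finset.univ : Finset ι) : Set ι) =
      Set.range A.col := by
    rw [Finset.coe_univ, Set.image_univ]; rfl
  have hrow : Set.range G = Set.range A.row := rfl
  rw [hrow, hcol, ← Matrix.rank_eq_finrank_span_row, ← Matrix.rank_eq_finrank_span_cols]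

/-- The characteristic polynomial at `2 ^ m` counts the `m`-tuples of flows having no common
zero. -/
theorem sum_neg_one_pow_mul_eq_card {ι : Type*} [Fintype ι] [DecidableEq ι] {n : ℕ}
    (G : Fin n → ι → ZMod 2)
    (m : ℕ) [Fintype (Submodule.span (ZMod 2) (Set.range G))] :
    ∑ B : Finset ι, (-1 : ℤ) ^ B.card * ((2 : ℤ) ^ m) ^
        (Module.finrank (ZMod 2) (Submodule.span (ZMod 2) (Set.range G)) -
          Module.finrank (ZMod 2)
            (Submodule.span (ZMod 2) ((fun e => fun i => G i e) '' (B : Set ι)))) =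
      ((univ.filter fun h : Fin m → Submodule.span (ZMod 2) (Set.range G) =>
        ∀ e, ∃ j, (h j).1 e ≠ 0).card : ℤ) := by
  classical
  have hB (B : Finset ι) : ((2 : ℤ) ^ m) ^
        (Module.finrank (ZMod 2) (Submodule.span (ZMod 2) (Set.range G)) -
          Module.finrank (ZMod 2)
            (Submodule.span (ZMod 2) ((fun e => fun i => G i e) '' (B : Set ι)))) =
      ((univ.filter fun h : Fin m → Submodule.span (ZMod 2) (Set.range G) =>
        ∀ j, ∀ e ∈ B, (h j).1 e = 0).card : ℤ) := by
    have h1 := Fintype.card_congr (Equiv.subtypePiEquivPi (α := Fin m)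
      (β := fun _ => Submodule.span (ZMod 2) (Set.range G))
      (p := fun {_} h => ∀ e ∈ B, h.1 e = 0))
    rw [Fintype.card_subtype, Fintype.card_pi_const, card_rowSpace_vanishing_s15 G B] at h1
    rw [h1, pow_right_comm]
    push_cast
    rfl
  simp_rw [hB, card_filter]
  push_cast
  simp_rw [mul_sum]
  rw [sum_comm]
  refine sum_congr rfl fun h _ => ?_
  have key := Finset.sum_powerset_neg_one_pow_card
    (x := univ.filter fun e => ∀ j, (h j).1 e = 0)
  rw [if_congr (show (∀ e, ∃ j, (h j).1 e ≠ 0) ↔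
    (univ.filter fun e => ∀ j, (h j).1 e = 0) = ∅ by simp [filter_eq_empty_iff]) rfl rfl, ← key]
  simp_rw [mul_ite, mul_one, mul_zero]
  rw [← sum_filter]
  refine sum_congr ?_ fun _ _ => rfl
  ext B
  simp only [mem_filter, mem_univ, true_and, mem_powerset, subset_iff]
  exact ⟨fun H e he j => H j e he, fun H j e he => H he j⟩

theorem exp_pow_add_exp_pow_sub (m a : ℕ) (ha : a ≤ m + 1) :
    Complex.exp (Real.pi * Complex.I / ((m : ℂ) + 1)) ^ a +
      Complex.exp (Real.pi * Complex.I / ((m : ℂ) + 1)) ^ (m + 1 - a) =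
      2 * Complex.I * (Real.sin (Real.pi * a / (m + 1)) : ℝ) := by
  have hm : (m : ℂ) + 1 ≠ 0 := by exact_mod_cast Nat.succ_ne_zero m
  rw [← Complex.exp_nat_mul, ← Complex.exp_nat_mul, Nat.cast_sub ha]
  have h2 : (((m + 1 : ℕ) : ℂ) - a) * (Real.pi * Complex.I / ((m : ℂ) + 1)) =
      Real.pi * Complex.I + -(Real.pi * a / (m + 1)) * Complex.I := by
    push_cast; field_simp; ring
  have h1 : (a : ℂ) * (Real.pi * Complex.I / ((m : ℂ) + 1)) =
      (Real.pi * a / (m + 1)) * Complex.I := by ring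
  rw [h1, h2, Complex.exp_add, Complex.exp_pi_mul_I, Complex.ofReal_sin, Complex.sin]
  push_cast
  have hI := Complex.I_sq
  linear_combination -(Complex.exp (-(Real.pi * a / (m + 1)) * Complex.I) -
    Complex.exp (Real.pi * a / (m + 1) * Complex.I)) * hI

theorem sin_pi_mul_div_nonneg (m a : ℕ) (ha : a ≤ m + 1) :
    0 ≤ Real.sin (Real.pi * a / (m + 1)) := by
  apply Real.sin_nonneg_of_nonneg_of_le_pi
  · positivity
  · rw [div_le_iff₀ (by positivity)]
    exact mul_le_mul_of_nonneg_left (by exact_mod_cast ha) Real.pi_pos.le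

theorem sin_pi_mul_div_ne_zero_iff (m a : ℕ) (ha : a ≤ m + 1) :
    Real.sin (Real.pi * a / (m + 1)) ≠ 0 ↔ a ≠ 0 ∧ a ≠ m + 1 := by
  have hm : (m : ℝ) + 1 ≠ 0 := by positivity
  constructor
  · intro h
    refine ⟨fun h0 => h (by simp [h0]), fun h1 => h ?_⟩
    rw [h1]; push_cast; rw [mul_div_cancel_right₀ _ hm, Real.sin_pi]
  · rintro ⟨h0, h1⟩
    apply ne_of_gt
    apply Real.sin_pos_of_pos_of_lt_pi
    · have : (0 : ℝ) < a := by exact_mod_cast Nat.pos_of_ne_zero h0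
      have := Real.pi_pos
      positivity
    · rw [div_lt_iff₀ (by positivity)]
      exact mul_lt_mul_of_pos_left (by exact_mod_cast lt_of_le_of_ne ha h1) Real.pi_pos

/-- Summing a weight depending on the total support size over all common translates of a tuple
factors over the columns. -/
theorem sum_pow_card_support_translate {ι : Type*} [Fintype ι] [DecidableEq ι] {k : ℕ}
    (z : ℂ) (f : Fin k → ι → ZMod 2) :
    ∑ g : ι → ZMod 2, z ^ ∑ j, (univ.filter fun e => (f j + g) e ≠ 0).card =
      ∏ e, (z ^ (univ.filter fun j => f j e ≠ 0).card +
        z ^ (k - (univ.filter fun j => f j e ≠ 0).card)) := by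
  have h1 (e : ι) : z ^ (univ.filter fun j => f j e ≠ 0).card +
        z ^ (k - (univ.filter fun j => f j e ≠ 0).card) =
      ∑ x : ZMod 2, z ^ (univ.filter fun j => f j e + x ≠ 0).card := by
    have h2 : (univ.filter fun j => f j e + 1 ≠ 0).card =
        k - (univ.filter fun j => f j e ≠ 0).card := by
      have := card_filter_add_card_filter_not (s := univ) (fun j => f j e ≠ 0)
      rw [card_univ, Fintype.card_fin] at this
      rw [← Nat.eq_sub_of_add_eq' this]
      congr 1
      refine filter_congr fun j _ => ?_
      generalize f j e = y
      revert y
      decide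
    rw [show (univ : Finset (ZMod 2)) = {0, 1} from rfl, sum_pair (by decide), h2]
    simp
  simp_rw [h1]
  rw [prod_univ_sum, Fintype.piFinset_univ]
  refine sum_congr rfl fun g _ => ?_
  rw [prod_pow_eq_pow_sum]
  congr 1
  simp_rw [card_filter]
  rw [sum_comm]
  rfl

theorem column_nonconstant_iff {m : ℕ} (c : Fin (m + 1) → ZMod 2) :
    ((univ.filter fun j => c j ≠ 0).card ≠ 0 ∧ (univ.filter fun j => c j ≠ 0).card ≠ m + 1) ↔
      ∃ j : Fin m, c j.castSucc - c j.succ ≠ 0 := by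
  have hcard : (univ.filter fun j => c j ≠ 0).card = m + 1 ↔ ∀ j, c j ≠ 0 := by
    have := card_filter_eq_iff (s := (univ : Finset (Fin (m + 1)))) (p := fun j => c j ≠ 0)
    simpa using this
  have hcard0 : (univ.filter fun j => c j ≠ 0).card = 0 ↔ ∀ j, c j = 0 := by
    simp [card_eq_zero, filter_eq_empty_iff]
  rw [Ne, Ne, hcard, hcard0, ← not_or, ← not_iff_not, not_not, not_exists]
  simp only [not_not, sub_eq_zero]
  constructor
  · rintro (h | h) j
    · rw [h, h]
    · have h1 := h j.castSucc
      have h2 := h j.succ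
      generalize c j.castSucc = x at *
      generalize c j.succ = y at *
      revert x y
      decide
  · intro h
    have h0 (j : Fin (m + 1)) : c j = c 0 := by
      induction j using Fin.induction with
      | zero => rfl
      | succ j ih => rw [← h, ih]
    by_cases hc : c 0 = 0
    · exact Or.inl fun j => by rw [h0, hc]
    · exact Or.inr fun j => by rwa [h0]

/-- A root-of-unity weighted sum over a translation-invariant set of tuples is nonzero exactly when
some tuple in it has no constant column. -/
theorem sum_exp_pow_card_support_ne_zero_iff {ι : Type*} [Fintype ι] [DecidableEq ι] {m : ℕ}
    (T : Finset (Fin (m + 1) → ι → ZMod 2))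
    (hT : ∀ (g : ι → ZMod 2) f, (fun j => f j + g) ∈ T ↔ f ∈ T) :
    ∑ f ∈ T, Complex.exp (Real.pi * Complex.I / ((m : ℂ) + 1)) ^
        (∑ j, (univ.filter fun e => f j e ≠ 0).card) ≠ 0 ↔
      ∃ f ∈ T, ∀ e, ∃ j : Fin m, f j.castSucc e - f j.succ e ≠ 0 := by
  set z := Complex.exp (Real.pi * Complex.I / ((m : ℂ) + 1))
  set S := ∑ f ∈ T, z ^ (∑ j, (univ.filter fun e => f j e ≠ 0).card)
  have hle (f : Fin (m + 1) → ι → ZMod 2) (e : ι) :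
      (univ.filter fun j => f j e ≠ 0).card ≤ m + 1 := by
    simpa using card_le_univ (univ.filter fun j => f j e ≠ 0)
  have htrans (g : ι → ZMod 2) :
      ∑ f ∈ T, z ^ (∑ j, (univ.filter fun e => (f j + g) e ≠ 0).card) = S := by
    refine sum_equiv (Equiv.addRight (fun _ => g)) (fun f => (hT g f).symm) fun f _ => rfl
  have hsum : (Fintype.card (ι → ZMod 2) : ℂ) * S =
      (2 * Complex.I) ^ Fintype.card ι * ((∑ f ∈ T, ∏ e,
        Real.sin (Real.pi * (univ.filter fun j => f j e ≠ 0).card / (m + 1)) : ℝ) : ℂ) := by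
    calc (Fintype.card (ι → ZMod 2) : ℂ) * S = ∑ g : ι → ZMod 2, S := by
          rw [sum_const, card_univ, nsmul_eq_mul]
      _ = ∑ f ∈ T, ∑ g : ι → ZMod 2,
            z ^ (∑ j, (univ.filter fun e => (f j + g) e ≠ 0).card) := by
          rw [sum_comm (s := T)]; exact sum_congr rfl fun g _ => (htrans g).symm
      _ = _ := by
          rw [Complex.ofReal_sum, mul_sum]
          refine sum_congr rfl fun f _ => ?_
          rw [sum_pow_card_support_translate, Complex.ofReal_prod, ← card_univ, ← prod_const,
            ← prod_mul_distrib]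
          exact prod_congr rfl fun e _ => exp_pow_add_exp_pow_sub m _ (hle f e)
  have hc : (Fintype.card (ι → ZMod 2) : ℂ) ≠ 0 := by
    exact_mod_cast Fintype.card_ne_zero
  have hI : (2 * Complex.I) ^ Fintype.card ι ≠ 0 :=
    pow_ne_zero _ (mul_ne_zero two_ne_zero Complex.I_ne_zero)
  rw [← and_iff_right (a := (Fintype.card (ι → ZMod 2) : ℂ) ≠ 0) (b := S ≠ 0) hc,
    ← mul_ne_zero_iff, hsum, mul_ne_zero_iff, and_iff_right hI, Complex.ofReal_ne_zero,
    Ne, sum_eq_zero_iff_of_nonneg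
      fun f _ => prod_nonneg fun e _ => sin_pi_mul_div_nonneg m _ (hle f e)]
  push Not
  refine exists_congr fun f => and_congr_right fun _ => ?_
  rw [prod_ne_zero_iff]
  simp only [mem_univ, true_imp_iff]
  exact forall_congr' fun e =>
    (sin_pi_mul_div_ne_zero_iff m _ (hle f e)).trans (column_nonconstant_iff fun j => f j e)

/-- **Theorem 5.6.** The alternating sum over the `2m+2` parcels of `(m+1)`-tuples is
nonzero iff the binary matroid `M(G)` has a nowhere-zero `2^m`-flow,
i.e. iff `χ(M(G); 2^m) ≠ 0`. -/
theorem stmt_15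
    {ι : Type*} [Fintype ι] [DecidableEq ι]
    {n : ℕ} (G : Fin n → ι → ZMod 2)
    (rk : Finset ι → ℕ)
    (hrk : ∀ B : Finset ι,
      rk B = Module.finrank (ZMod 2)
        (Submodule.span (ZMod 2) ((fun e => fun i => G i e) '' (B : Set ι))))
    (r : ℕ) (hr : r = rk Finset.univ)
    (Flow : (ι → ZMod 2) → Prop) [DecidablePred Flow]
    (hFlow : ∀ h : ι → ZMod 2, Flow h ↔ h ∈ Submodule.span (ZMod 2) (Set.range G))
    (m : ℕ) (hm : 2 ≤ m) :
    (∑ k ∈ Finset.range (2 * m + 2),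
        Complex.exp ((k : ℂ) * Real.pi * Complex.I / ((m : ℂ) + 1)) *
          ((Finset.univ.filter (fun f : Fin (m + 1) → ι → ZMod 2 =>
            (∀ j : Fin m, Flow (f j.castSucc - f j.succ)) ∧
              (∑ j : Fin (m + 1),
                (Finset.univ.filter (fun e => f j e ≠ 0)).card) % (2 * m + 2) = k)).card : ℂ)
        ≠ 0)
      ↔ (∑ B : Finset ι, (-1 : ℤ) ^ B.card * ((2 : ℤ) ^ m) ^ (r - rk B) ≠ 0) := by
  classical
  have hrkr : r = Module.finrank (ZMod 2) (Submodule.span (ZMod 2) (Set.range G)) := by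
    rw [hr, hrk, finrank_rowSpace_eq]
  simp_rw [hrk, hrkr]
  rw [sum_neg_one_pow_mul_eq_card, Nat.cast_ne_zero, ← Nat.pos_iff_ne_zero, card_pos]
  set T := univ.filter fun f : Fin (m + 1) → ι → ZMod 2 =>
    ∀ j : Fin m, Flow (f j.castSucc - f j.succ) with hTdef
  set z := Complex.exp (Real.pi * Complex.I / ((m : ℂ) + 1)) with hz
  have hm0 : (m : ℂ) + 1 ≠ 0 := by exact_mod_cast Nat.succ_ne_zero m
  have hz1 : z ^ (2 * m + 2) = 1 := by
    rw [hz, ← Complex.exp_nat_mul, Complex.exp_eq_one_iff]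
    refine ⟨1, ?_⟩
    push_cast
    field_simp
  have hzk (k : ℕ) : Complex.exp ((k : ℂ) * Real.pi * Complex.I / ((m : ℂ) + 1)) = z ^ k := by
    rw [hz, ← Complex.exp_nat_mul]
    congr 1
    ring
  have hsum : ∑ f ∈ T, z ^ (∑ j, (univ.filter fun e => f j e ≠ 0).card) =
      ∑ k ∈ Finset.range (2 * m + 2),
        Complex.exp ((k : ℂ) * Real.pi * Complex.I / ((m : ℂ) + 1)) *
          ((Finset.univ.filter (fun f : Fin (m + 1) → ι → ZMod 2 =>
            (∀ j : Fin m, Flow (f j.castSucc - f j.succ)) ∧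
              (∑ j : Fin (m + 1),
                (Finset.univ.filter (fun e => f j e ≠ 0)).card) % (2 * m + 2) = k)).card : ℂ) := by
    rw [← sum_fiberwise_of_maps_to (t := Finset.range (2 * m + 2))
      (g := fun f : Fin (m + 1) → ι → ZMod 2 =>
        (∑ j, (univ.filter fun e => f j e ≠ 0).card) % (2 * m + 2))
      fun f _ => mem_range.2 (Nat.mod_lt _ (by omega))]
    refine sum_congr rfl fun k _ => ?_
    rw [hzk, hTdef, filter_filter, mul_comm (z ^ k), ← nsmul_eq_mul, ← sum_const]
    refine sum_congr rfl fun f hf => ?_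
    rw [← (mem_filter.1 hf).2.2, ← pow_eq_pow_mod _ hz1]
  rw [← hsum, sum_exp_pow_card_support_ne_zero_iff T fun g f => by simp [hTdef]]
  constructor
  · rintro ⟨f, hf, hne⟩
    rw [hTdef, mem_filter] at hf
    exact ⟨fun j => ⟨_, (hFlow _).1 (hf.2 j)⟩, mem_filter.2 ⟨mem_univ _, hne⟩⟩
  · rintro ⟨h, hh⟩
    have hdiff (j : Fin m) : Fin.partialSum (fun i => -(h i).1) j.castSucc -
        Fin.partialSum (fun i => -(h i).1) j.succ = (h j).1 := by
      rw [Fin.partialSum_succ, sub_add_cancel_left, neg_neg]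
    refine ⟨Fin.partialSum fun i => -(h i).1, ?_, fun e => ?_⟩
    · rw [hTdef, mem_filter]
      exact ⟨mem_univ _, fun j => (hFlow _).2 (hdiff j ▸ (h j).2)⟩
    · obtain ⟨j, hj⟩ := (mem_filter.1 hh).2 e
      exact ⟨j, by rwa [← Pi.sub_apply, hdiff]⟩
end

section
/- Let p be an odd prime, ω a primitive p-th root of unity in ℂ, E a finite set, and G a matrix over GF(p) with columns indexed by E. For a ∈ GF(p), let ℳ^•(a, p) be the set of pairs (f, g) of functions f, g : E → GF(p) such that f − g is a flow of G and ⟨f, g⟩ = a, where ⟨f, g⟩ = Σ_{e ∈ E} f(e)g(e) ∈ GF(p). Then Σ_{a ∈ GF(p)} ω^a |ℳ^•(a, p)| = Ω^{|E|} Σ_{h : h is a flow of G} ω^{−⟨h,h⟩/4}, where Ω = Σ_{b ∈ GF(p)} ω^{b²} = 1 + Σ_{b : b is a nonzero square in GF(p)} 2ω^b, the exponent −(1/4)⟨h,h⟩ is computed in GF(p) (4 is invertible since p is odd), and for c ∈ GF(p) the power ω^c means ω raised to the canonical integer representative of c in {0, 1, …, p−1}. -/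
open Finset

/-- An additive character maps finite sums to finite products. -/
theorem AddChar.map_finsetSum_eq_prod {A M ι : Type*} [AddCommMonoid A] [CommMonoid M]
    (ψ : AddChar A M) (s : Finset ι) (f : ι → A) : ψ (∑ i ∈ s, f i) = ∏ i ∈ s, ψ (f i) := by
  classical
  induction s using Finset.induction_on with
  | empty => simp
  | insert i s hi ih => rw [Finset.sum_insert hi, Finset.prod_insert hi, ψ.map_add_eq_mul, ih]

/-- An additive character of a sum of squares, summed over all vectors, is a power of the
quadratic Gauss sum. -/
theorem AddChar.sum_sum_sq_eq_pow {R S ι : Type*} [CommRing R] [Fintype R] [CommRing S]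
    [Fintype ι] [DecidableEq ι] (ψ : AddChar R S) :
    ∑ s : ι → R, ψ (∑ e, s e ^ 2) = (∑ b : R, ψ (b ^ 2)) ^ Fintype.card ι := by
  simp_rw [AddChar.map_finsetSum_eq_prod]
  rw [← Fintype.prod_sum (fun (_ : ι) (b : R) => ψ (b ^ 2))]
  simp

/-- Midpoint and difference coordinates on pairs, `(s, h) ↦ (s + c h, s - c h)`, where `2 c = 1`. -/
def midpointDiffEquiv {R ι : Type*} [CommRing R] (c : R) (hc : 2 * c = 1) :
    (ι → R) × (ι → R) ≃ (ι → R) × (ι → R) where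
  toFun q := (fun e => q.1 e + c * q.2 e, fun e => q.1 e - c * q.2 e)
  invFun q := (fun e => c * (q.1 e + q.2 e), fun e => q.1 e - q.2 e)
  left_inv q := by
    ext e
    · linear_combination q.1 e * hc
    · linear_combination q.2 e * hc
  right_inv q := by
    ext e
    · linear_combination q.1 e * hc
    · linear_combination q.2 e * hc

/-- Evaluation of the sum of `ψ ⟨f, g⟩` over the pairs whose difference satisfies `P`. -/
theorem AddChar.sum_pairs_eq_pow_mul_sum {R S ι : Type*} [CommRing R] [Fintype R] [DecidableEq R]
    [CommRing S] [Fintype ι] [DecidableEq ι] (ψ : AddChar R S) (c : R) (hc : 2 * c = 1)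
    (P : (ι → R) → Prop) [DecidablePred P] :
    ∑ q : (ι → R) × (ι → R) with P (q.1 - q.2), ψ (∑ e, q.1 e * q.2 e) =
      (∑ b : R, ψ (b ^ 2)) ^ Fintype.card ι *
        ∑ h with P h, ψ (-(∑ e, h e * h e) * (c * c)) := by
  rw [← ψ.sum_sum_sq_eq_pow, Finset.sum_filter, Finset.sum_filter,
    ← (midpointDiffEquiv c hc).sum_comp, Fintype.sum_prod_type, Finset.sum_mul_sum]
  refine Finset.sum_congr rfl fun s _ => Finset.sum_congr rfl fun h _ => ?_
  have hd : (midpointDiffEquiv c hc (s, h)).1 - (midpointDiffEquiv c hc (s, h)).2 = h := by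
    ext e
    simp only [midpointDiffEquiv, Equiv.coe_fn_mk, Pi.sub_apply]
    linear_combination h e * hc
  rw [hd, mul_ite, mul_zero, ← AddChar.map_add_eq_mul]
  congr 2
  rw [← Finset.sum_neg_distrib, Finset.sum_mul, ← Finset.sum_add_distrib]
  refine Finset.sum_congr rfl fun e _ => ?_
  simp only [midpointDiffEquiv, Equiv.coe_fn_mk]
  ring

/-- **Theorem 6.1.** Parcels defined by inner products over GF(p), p an odd prime:
`Σ_a ω^a |ℳ^•(a,p)| = Ω^{|E|} Σ_{h flow} ω^{−⟨h,h⟩/4}` where `Ω = Σ_b ω^{b²}`. -/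
theorem stmt_16
    (p : ℕ) [Fact p.Prime] (hodd : Odd p)
    {ι : Type*} [Fintype ι] [DecidableEq ι]
    {n : ℕ} (G : Fin n → ι → ZMod p)
    (Flow : (ι → ZMod p) → Prop) [DecidablePred Flow]
    (hFlow : ∀ h : ι → ZMod p, Flow h ↔ h ∈ Submodule.span (ZMod p) (Set.range G))
    (ω : ℂ) (hω : ω ^ p = 1) (hω1 : ω ≠ 1) :
    ∑ a : ZMod p, ω ^ a.val *
        ((Finset.univ.filter (fun q : (ι → ZMod p) × (ι → ZMod p) =>
          Flow (q.1 - q.2) ∧ ∑ e : ι, q.1 e * q.2 e = a)).card : ℂ)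
      = (∑ b : ZMod p, ω ^ (b ^ 2).val) ^ (Fintype.card ι) *
          ∑ h ∈ Finset.univ.filter Flow,
            ω ^ ((-(∑ e : ι, h e * h e) * (4 : ZMod p)⁻¹).val) := by
  have h2 : (2 : ZMod p) ≠ 0 := by
    refine Ring.two_ne_zero ?_
    rw [ZMod.ringChar_zmod_n]
    rintro rfl
    exact absurd hodd (by decide)
  have h4 : (4 : ZMod p)⁻¹ = 2⁻¹ * 2⁻¹ := by
    rw [← mul_inv]
    norm_num
  have key := (AddChar.zmodChar p hω).sum_pairs_eq_pow_mul_sum (2 : ZMod p)⁻¹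
    (mul_inv_cancel₀ h2) Flow
  simp only [AddChar.zmodChar_apply] at key
  rw [h4, ← key, ← Finset.sum_fiberwise _ (fun q : (ι → ZMod p) × (ι → ZMod p) => ∑ e, q.1 e * q.2 e)]
  refine Finset.sum_congr rfl fun a _ => ?_
  rw [Finset.filter_filter, mul_comm, ← nsmul_eq_mul]
  refine (Finset.sum_const _).symm.trans ?_
  exact Finset.sum_congr rfl fun q hq => by rw [(Finset.mem_filter.mp hq).2.2]
end

section
/- Let E be a finite set and G a matrix over GF(3) with columns indexed by E, of rank r. For a ∈ GF(3), let ℳ^•(a, 3) be the set of pairs (f, g) of functions f, g : E → GF(3) such that f − g is a flow of G and ⟨f, g⟩ = a, where ⟨f, g⟩ = Σ_{e ∈ E} f(e)g(e) ∈ GF(3). Then |ℳ^•(0, 3)| + e^{2πi/3} |ℳ^•(1, 3)| + e^{−2πi/3} |ℳ^•(−1, 3)| = e^{(5r − |E|)πi/6} (√3)^{|E| + r} R(M(G); √3·e^{−5πi/6}, √3·e^{5πi/6}). -/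
open Finset

/-- Rank-nullity for the restriction of the row space of `G` to a set `B` of columns. -/
lemma finrank_span_cols_add_finrank_vanishing {F ι : Type*} [Field F] [Fintype ι]
    {n : ℕ} (G : Fin n → ι → F) (B : Finset ι) :
    Module.finrank F (Submodule.span F ((fun e => fun i => G i e) '' (B : Set ι)))
      + Module.finrank F (((LinearMap.funLeft F F (Subtype.val : B → ι)).domRestrict
          (Submodule.span F (Set.range G))).ker)
      = Module.finrank F (Submodule.span F (Set.range G)) := by
  rw [← LinearMap.finrank_range_add_finrank_ker ((LinearMap.funLeft F F
    (Subtype.val : B → ι)).domRestrict (Submodule.span F (Set.range G))),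
    LinearMap.range_domRestrict, Submodule.map_span]
  congr 1
  let A : Matrix (Fin n) B F := Matrix.of fun i e => G i e
  have hcols : (fun e => fun i => G i e) '' (B : Set ι) = Set.range A.col := by
    ext v
    simp [A, Matrix.col_def, Set.mem_range, funext_iff]
  have hrows : LinearMap.funLeft F F (Subtype.val : B → ι) '' Set.range G = Set.range A.row := by
    rw [← Set.range_comp]
    rfl
  rw [hcols, hrows, ← Matrix.rank_eq_finrank_span_cols, ← Matrix.rank_eq_finrank_span_row]

lemma finrank_span_rows_eq_cols {F ι : Type*} [Field F] [Fintype ι] {n : ℕ} (G : Fin n → ι → F) :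
    Module.finrank F (Submodule.span F (Set.range G)) =
      Module.finrank F (Submodule.span F
        ((fun e => fun i => G i e) '' ((Finset.univ : Finset ι) : Set ι))) := by
  have h := (Matrix.rank_eq_finrank_span_cols (Matrix.of G)).symm.trans
    (Matrix.rank_eq_finrank_span_row (Matrix.of G))
  rw [Finset.coe_univ, Set.image_univ]
  exact h.symm

/-- The number of vectors in the row space of `G` that vanish on a set `B` of columns is `q ^ k`,
where `k` is the rank of `G` minus the rank of the columns indexed by `B`. -/
lemma card_vanishing_eq_pow {F ι : Type*} [Field F] [Fintype F] [Fintype ι] [DecidableEq ι]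
    {n : ℕ} (G : Fin n → ι → F) (B : Finset ι)
    (S : Finset (ι → F))
    (hS : ∀ h, h ∈ S ↔ h ∈ Submodule.span F (Set.range G) ∧ ∀ e ∈ B, h e = 0) :
    S.card = Fintype.card F ^
      (Module.finrank F (Submodule.span F (Set.range G)) -
        Module.finrank F (Submodule.span F ((fun e => fun i => G i e) '' (B : Set ι)))) := by
  rw [← finrank_span_cols_add_finrank_vanishing G B, Nat.add_sub_cancel_left]
  classical
  rw [← Module.card_eq_pow_finrank (V := ((LinearMap.funLeft F F
    (Subtype.val : B → ι)).domRestrict (Submodule.span F (Set.range G))).ker), ← Finset.card_univ]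
  symm
  refine Finset.card_bij (fun v _ => (v : ι → F)) (fun v _ => ?_) (fun v _ w _ h => ?_)
    fun h hh => ?_
  · refine (hS _).2 ⟨v.1.2, fun e he => ?_⟩
    exact congrFun (LinearMap.mem_ker.mp v.2) ⟨e, he⟩
  · exact Subtype.ext (Subtype.ext h)
  · obtain ⟨hmem, hzero⟩ := (hS h).1 hh
    refine ⟨⟨⟨h, hmem⟩, ?_⟩, Finset.mem_univ _, rfl⟩
    rw [LinearMap.mem_ker]
    ext e
    exact hzero e e.2

/-- Substituting `f = g + h` factors the character sum over pairs with `P (f - g)`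
coordinatewise. -/
lemma sum_addChar_dotProduct {F ι : Type*} [CommRing F] [Fintype F] [DecidableEq F] [Fintype ι]
    [DecidableEq ι] (χ : AddChar F ℂ) (P : (ι → F) → Prop) [DecidablePred P] :
    ∑ q : (ι → F) × (ι → F) with P (q.1 - q.2), χ (∑ e, q.1 e * q.2 e) =
      ∑ h : ι → F with P h, ∏ e, ∑ t : F, χ ((t + h e) * t) := by
  simp_rw [Finset.sum_filter, Fintype.sum_prod_type_right]
  have (g : ι → F) := (Equiv.sum_comp (Equiv.addLeft g) fun f : ι → F =>
    if P (f - g) then χ (∑ e, f e * g e) else 0).symm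
  simp_rw [this]
  rw [Finset.sum_comm]
  refine Finset.sum_congr rfl fun h _ => ?_
  simp only [Equiv.coe_addLeft, add_sub_cancel_left, Pi.add_apply]
  split_ifs
  · rw [Fintype.prod_sum]
    exact Finset.sum_congr rfl fun g _ =>
      map_prod χ.toMonoidHom (fun e => Multiplicative.ofAdd ((g e + h e) * g e)) univ
  · simp

/-- The weight enumerator of a linear code as a sum over sets of coordinates. -/
lemma sum_prod_one_add_ite {F ι : Type*} [Field F] [Fintype F] [DecidableEq F] [Fintype ι]
    [DecidableEq ι] {n : ℕ} (G : Fin n → ι → F) (P : (ι → F) → Prop) [DecidablePred P]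
    (hP : ∀ h, P h ↔ h ∈ Submodule.span F (Set.range G)) (x : ℂ) :
    ∑ h : ι → F with P h, ∏ e, (1 + if h e = 0 then x else 0) =
      ∑ B : Finset ι, (Fintype.card F : ℂ) ^
        (Module.finrank F (Submodule.span F (Set.range G)) -
          Module.finrank F (Submodule.span F ((fun e => fun i => G i e) '' (B : Set ι)))) *
        x ^ B.card := by
  simp_rw [Finset.prod_one_add, Finset.powerset_univ]
  rw [Finset.sum_comm]
  refine Finset.sum_congr rfl fun B _ => ?_
  rw [← Nat.cast_pow, ← card_vanishing_eq_pow G B (univ.filter fun h => P h ∧ ∀ e ∈ B, h e = 0)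
    (by simp [hP]), ← Finset.filter_filter, ← nsmul_eq_mul, ← Finset.sum_const,
    Finset.sum_filter (fun h : ι → F => ∀ e ∈ B, h e = 0)]
  refine Finset.sum_congr rfl fun h _ => ?_
  rw [Finset.prod_ite_zero]
  simp

lemma exp_five_pi_div_six :
    Complex.exp (5 * Real.pi * Complex.I / 6) = (-(Real.sqrt 3 : ℂ) + Complex.I) / 2 := by
  have : (5 * Real.pi * Complex.I / 6 : ℂ) = (Real.pi - Real.pi / 6 : ℝ) * Complex.I := by
    push_cast; ring
  rw [this, Complex.exp_mul_I, ← Complex.ofReal_cos, ← Complex.ofReal_sin, Real.cos_pi_sub,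
    Real.sin_pi_sub, Real.cos_pi_div_six, Real.sin_pi_div_six]
  push_cast; ring

lemma exp_neg_five_pi_div_six :
    Complex.exp (-(5 * Real.pi * Complex.I) / 6) = (-(Real.sqrt 3 : ℂ) - Complex.I) / 2 := by
  have : (-(5 * Real.pi * Complex.I) / 6 : ℂ) = (-(Real.pi - Real.pi / 6) : ℝ) * Complex.I := by
    push_cast; ring
  rw [this, Complex.exp_mul_I, ← Complex.ofReal_cos, ← Complex.ofReal_sin, Real.cos_neg,
    Real.sin_neg, Real.cos_pi_sub, Real.sin_pi_sub, Real.cos_pi_div_six, Real.sin_pi_div_six]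
  push_cast; ring

lemma exp_neg_pi_div_six :
    Complex.exp (-(Real.pi * Complex.I) / 6) = ((Real.sqrt 3 : ℂ) - Complex.I) / 2 := by
  have : (-(Real.pi * Complex.I) / 6 : ℂ) = (-(Real.pi / 6) : ℝ) * Complex.I := by
    push_cast; ring
  rw [this, Complex.exp_mul_I, ← Complex.ofReal_cos, ← Complex.ofReal_sin, Real.cos_neg,
    Real.sin_neg, Real.cos_pi_div_six, Real.sin_pi_div_six]
  push_cast; ring

lemma exp_two_pi_div_three :
    Complex.exp (2 * Real.pi * Complex.I / 3) = (-1 + (Real.sqrt 3 : ℂ) * Complex.I) / 2 := by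
  have : (2 * Real.pi * Complex.I / 3 : ℂ) = (Real.pi - Real.pi / 3 : ℝ) * Complex.I := by
    push_cast; ring
  rw [this, Complex.exp_mul_I, ← Complex.ofReal_cos, ← Complex.ofReal_sin, Real.cos_pi_sub,
    Real.sin_pi_sub, Real.cos_pi_div_three, Real.sin_pi_div_three]
  push_cast; ring

/-- **Corollary 6.2.** Inner-product parcels for a ternary matrix:
`|ℳ^•(0,3)| + e^{2πi/3}|ℳ^•(1,3)| + e^{−2πi/3}|ℳ^•(−1,3)|
  = e^{(5r−|E|)πi/6} √3^{|E|+r} R(M(G); √3 e^{−5πi/6}, √3 e^{5πi/6})`. -/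
theorem stmt_17
    {ι : Type*} [Fintype ι] [DecidableEq ι]
    {n : ℕ} (G : Fin n → ι → ZMod 3)
    (rk : Finset ι → ℕ)
    (hrk : ∀ B : Finset ι,
      rk B = Module.finrank (ZMod 3)
        (Submodule.span (ZMod 3) ((fun e => fun i => G i e) '' (B : Set ι))))
    (r : ℕ) (hr : r = rk Finset.univ)
    (Flow : (ι → ZMod 3) → Prop) [DecidablePred Flow]
    (hFlow : ∀ h : ι → ZMod 3, Flow h ↔ h ∈ Submodule.span (ZMod 3) (Set.range G))
    (M : ZMod 3 → ℕ)
    (hM : ∀ a : ZMod 3, M a = (Finset.univ.filter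
        (fun q : (ι → ZMod 3) × (ι → ZMod 3) =>
          Flow (q.1 - q.2) ∧ ∑ e : ι, q.1 e * q.2 e = a)).card) :
    (M 0 : ℂ) + Complex.exp (2 * Real.pi * Complex.I / 3) * (M 1 : ℂ)
        + Complex.exp (-(2 * Real.pi * Complex.I) / 3) * (M (-1) : ℂ)
      = Complex.exp ((5 * (r : ℂ) - (Fintype.card ι : ℂ)) * Real.pi * Complex.I / 6)
          * (Real.sqrt 3 : ℂ) ^ (Fintype.card ι + r) *
          ∑ B : Finset ι,
            ((Real.sqrt 3 : ℂ) * Complex.exp (-(5 * Real.pi * Complex.I) / 6)) ^ (r - rk B) *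
              ((Real.sqrt 3 : ℂ) * Complex.exp (5 * Real.pi * Complex.I / 6)) ^ (B.card - rk B) := by
  set s : ℂ := (Real.sqrt 3 : ℂ) with hs
  have hss : s ^ 2 = 3 := by
    rw [hs, ← Complex.ofReal_pow, Real.sq_sqrt (by norm_num)]
    norm_num
  have hI : Complex.I ^ 2 = -1 := Complex.I_sq
  set ω := Complex.exp (2 * Real.pi * Complex.I / 3) with hω
  have hω3 : ω ^ 3 = 1 := by
    rw [hω, ← Complex.exp_nat_mul, ← Complex.exp_two_pi_mul_I]
    congr 1
    push_cast
    ring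
  have hω2 : Complex.exp (-(2 * Real.pi * Complex.I) / 3) = ω ^ 2 := by
    rw [neg_div, Complex.exp_neg, ← hω]
    exact inv_eq_of_mul_eq_one_left (by rw [← hω3]; ring)
  have hx : s * Complex.exp (5 * Real.pi * Complex.I / 6) = ω - 1 := by
    rw [exp_five_pi_div_six, hω, exp_two_pi_div_three]
    linear_combination (-1 / 2) * hss
  have hc : s * Complex.exp (-(Real.pi * Complex.I) / 6) = 2 + ω ^ 2 := by
    rw [exp_neg_pi_div_six, hω, exp_two_pi_div_three]
    linear_combination (1 / 2 - Complex.I ^ 2 / 4) * hss - 3 / 4 * hI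
  have hlx : s * Complex.exp (-(5 * Real.pi * Complex.I) / 6) * (ω - 1) = 3 := by
    rw [← hx, neg_div, Complex.exp_neg]
    field_simp
    exact hss
  let χ : AddChar (ZMod 3) ℂ := AddChar.zmodChar 3 hω3
  have hχ0 : χ 0 = 1 := AddChar.map_zero_eq_one χ
  have hχ1 : χ 1 = ω := (AddChar.zmodChar_apply hω3 1).trans (pow_one ω)
  have hχ2 : χ (-1) = ω ^ 2 := AddChar.zmodChar_apply hω3 (-1)
  have hχ2' : χ 2 = ω ^ 2 := hχ2
  have hlhs : (M 0 : ℂ) + ω * M 1 + ω ^ 2 * M (-1) =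
      ∑ q : (ι → ZMod 3) × (ι → ZMod 3) with Flow (q.1 - q.2), χ (∑ e, q.1 e * q.2 e) := by
    rw [← Finset.sum_fiberwise _ (fun q : (ι → ZMod 3) × (ι → ZMod 3) => ∑ e, q.1 e * q.2 e)]
    have (a : ZMod 3) : ∑ q ∈ univ.filter (fun q : (ι → ZMod 3) × (ι → ZMod 3) =>
        Flow (q.1 - q.2)) with ∑ e, q.1 e * q.2 e = a, χ (∑ e, q.1 e * q.2 e) = M a * χ a := by
      rw [hM, ← Finset.filter_filter, ← nsmul_eq_mul, ← Finset.sum_const]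
      exact Finset.sum_congr rfl fun q hq => by rw [(Finset.mem_filter.mp hq).2]
    simp_rw [this]
    have huniv : (univ : Finset (ZMod 3)) = {0, 1, -1} := by decide
    rw [huniv, Finset.sum_insert (by decide), Finset.sum_pair (by decide), hχ0, hχ1, hχ2]
    ring
  have hgauss (c : ZMod 3) : ∑ t : ZMod 3, χ ((t + c) * t) =
      (2 + ω ^ 2) * (1 + if c = 0 then ω - 1 else 0) := by
    have huniv : (univ : Finset (ZMod 3)) = {0, 1, 2} := by decide
    rw [huniv, Finset.sum_insert (by decide), Finset.sum_pair (by decide)]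
    have h3 : c = 0 ∨ c = 1 ∨ c = 2 := by revert c; decide
    rcases h3 with rfl | rfl | rfl
    · rw [show ((0 + 0) * 0 : ZMod 3) = 0 by decide, show ((1 + 0) * 1 : ZMod 3) = 1 by decide,
        show ((2 + 0) * 2 : ZMod 3) = 1 by decide, hχ0, hχ1, if_pos rfl]
      linear_combination -hω3
    · rw [show ((0 + 1) * 0 : ZMod 3) = 0 by decide, show ((1 + 1) * 1 : ZMod 3) = 2 by decide,
        show ((2 + 1) * 2 : ZMod 3) = 0 by decide, hχ0, hχ2', if_neg (by decide)]
      ring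
    · rw [show ((0 + 2) * 0 : ZMod 3) = 0 by decide, show ((1 + 2) * 1 : ZMod 3) = 0 by decide,
        show ((2 + 2) * 2 : ZMod 3) = 2 by decide, hχ0, hχ2', if_neg (by decide)]
      ring
  have hrank : Module.finrank (ZMod 3) (Submodule.span (ZMod 3) (Set.range G)) = r := by
    rw [hr, hrk, finrank_span_rows_eq_cols]
  have hprefactor : Complex.exp ((5 * (r : ℂ) - (Fintype.card ι : ℂ)) * Real.pi * Complex.I / 6)
      * s ^ (Fintype.card ι + r) = (2 + ω ^ 2) ^ Fintype.card ι * (ω - 1) ^ r := by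
    rw [← hc, ← hx, mul_pow, mul_pow, ← Complex.exp_nat_mul, ← Complex.exp_nat_mul, pow_add,
      mul_mul_mul_comm, ← Complex.exp_add, mul_comm]
    congr 2
    ring
  rw [hω2, hlhs, sum_addChar_dotProduct]
  simp_rw [hgauss, Finset.prod_mul_distrib]
  rw [← Finset.mul_sum, Finset.prod_const, Finset.card_univ, sum_prod_one_add_ite G Flow hFlow,
    hprefactor, hx, mul_assoc]
  congr 1
  rw [Finset.mul_sum]
  refine Finset.sum_congr rfl fun B _ => ?_
  have hle : rk B ≤ r := by
    rw [← hrank, hrk, ← finrank_span_cols_add_finrank_vanishing G B]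
    exact Nat.le_add_right _ _
  have hcard : rk B ≤ B.card := by
    rw [hrk, ← Finset.coe_image]
    exact (finrank_span_finset_le_card _).trans Finset.card_image_le
  rw [hrank, ← hrk, ZMod.card, Nat.cast_ofNat, ← hlx, mul_pow]
  obtain ⟨k, rfl⟩ := Nat.exists_eq_add_of_le hle
  obtain ⟨l, hl⟩ := Nat.exists_eq_add_of_le hcard
  rw [hl, Nat.add_sub_cancel_left, Nat.add_sub_cancel_left]
  ring
end
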